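/- Let N ≥ 1, m > 1, 0 < p < 1 with m + p < 2, and let σ ≥ 0. Let u₀ : ℝ^N → [0,∞) be continuous, bounded, compactly supported and not identically zero. If u is a weak solution to the Cauchy problem for ∂_t u = Δ(u^m) + (1+|x|)^σ u^p on ℝ^N × (0,T) with initial datum u₀, and u is continuous on ℝ^N × (0,T), then u(x,t) > 0 for every x ∈ ℝ^N and every t ∈ (0,T) (infinite speed of propagation). -/

import Mathlib

open MeasureTheory Set Filter
open scoped RealInnerProductSpace

noncomputable section

/-- The spatial Laplacian of a function on `EuclideanSpace ℝ (Fin N)`. -/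
def lapl {N : ℕ} (f : EuclideanSpace ℝ (Fin N) → ℝ) (x : EuclideanSpace ℝ (Fin N)) : ℝ :=
  ∑ i : Fin N,
    fderiv ℝ (fun y => fderiv ℝ f y (EuclideanSpace.single i (1 : ℝ))) x
      (EuclideanSpace.single i (1 : ℝ))

/-- Test functions: smooth, compactly supported in `ℝ^N × (0,T)`. -/
def IsTestFn {N : ℕ} (T : ℝ) (η : EuclideanSpace ℝ (Fin N) → ℝ → ℝ) : Prop :=
  ContDiff ℝ (⊤ : ℕ∞) (Function.uncurry η) ∧ HasCompactSupport (Function.uncurry η) ∧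
    ∀ (x : EuclideanSpace ℝ (Fin N)) (t : ℝ), t ∉ Ioo 0 T → η x t = 0

/-- Weak solution of `∂ₜ u = Δ(u^m) + (1+|x|)^σ u^p` on `ℝ^N × (0,T)` with initial datum `u₀`. -/
structure IsWeakSolution {N : ℕ} (m p σ T : ℝ)
    (u : EuclideanSpace ℝ (Fin N) → ℝ → ℝ)
    (u₀ : EuclideanSpace ℝ (Fin N) → ℝ) : Prop where
  nonneg : ∀ x, ∀ t ∈ Ioo 0 T, 0 ≤ u x t
  timeContL1 : ∀ K : Set (EuclideanSpace ℝ (Fin N)), IsCompact K → ∀ s ∈ Ioo 0 T,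
    Tendsto (fun t => ∫ x in K, |u x t - u x s|) (nhdsWithin s (Ioo 0 T)) (nhds 0)
  locBdd : ∀ K : Set (EuclideanSpace ℝ (Fin N)), IsCompact K → ∀ a b : ℝ, 0 < a → b < T →
    ∃ C : ℝ, ∀ x ∈ K, ∀ t ∈ Icc a b, u x t ≤ C
  weakForm : ∀ η : EuclideanSpace ℝ (Fin N) → ℝ → ℝ, IsTestFn T η → ∀ t ∈ Ioo 0 T,
    ((∫ x, u x t * η x t) +
      ∫ τ in Ioo (0:ℝ) t, ∫ x,
        (-(u x τ * deriv (η x) τ) - u x τ ^ m * lapl (fun y => η y τ) x)) =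
    ∫ τ in Ioo (0:ℝ) t, ∫ x, (1 + ‖x‖) ^ σ * u x τ ^ p * η x τ
  initL1 : ∀ K : Set (EuclideanSpace ℝ (Fin N)), IsCompact K →
    Tendsto (fun t => ∫ x in K, |u x t - u₀ x|) (nhdsWithin 0 (Ioi 0)) (nhds 0)

/-- Bounded measurable real functions. -/
def BddMeas {X : Type*} [MeasurableSpace X] (f : X → ℝ) : Prop :=
  Measurable f ∧ ∃ C, ∀ x, |f x| ≤ C

namespace BddMeas
variable {X : Type*} [MeasurableSpace X] {f g : X → ℝ}

lemma const (c : ℝ) : BddMeas (fun _ : X => c) := ⟨measurable_const, |c|, fun _ => le_rfl⟩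

lemma add (hf : BddMeas f) (hg : BddMeas g) : BddMeas (fun x => f x + g x) := by
  obtain ⟨hf, C, hC⟩ := hf
  obtain ⟨hg, D, hD⟩ := hg
  exact ⟨hf.add hg, C + D, fun x => (abs_add_le _ _).trans (add_le_add (hC x) (hD x))⟩

lemma mul (hf : BddMeas f) (hg : BddMeas g) : BddMeas (fun x => f x * g x) := by
  obtain ⟨hf, C, hC⟩ := hf
  obtain ⟨hg, D, hD⟩ := hg
  refine ⟨hf.mul hg, C * D, fun x => ?_⟩
  rw [abs_mul]
  exact mul_le_mul (hC x) (hD x) (abs_nonneg _) ((abs_nonneg _).trans (hC x))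

lemma sub (hf : BddMeas f) (hg : BddMeas g) : BddMeas (fun x => f x - g x) := by
  simpa [sub_eq_add_neg] using hf.add ((const (-1)).mul hg)

lemma max_zero (hf : BddMeas f) : BddMeas (fun x => max (f x) 0) := by
  obtain ⟨hf, C, hC⟩ := hf
  refine ⟨hf.max measurable_const, C, fun x => ?_⟩
  rw [abs_of_nonneg (le_max_right _ _)]
  exact max_le ((le_abs_self _).trans (hC x)) ((abs_nonneg _).trans (hC x))

lemma abs (hf : BddMeas f) : BddMeas (fun x => |f x|) := by
  obtain ⟨hf, C, hC⟩ := hf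
  exact ⟨hf.abs, C, fun x => by simpa using hC x⟩

lemma integrable (hf : BddMeas f) (μ : Measure X) [IsFiniteMeasure μ] : Integrable f μ := by
  obtain ⟨hf, C, hC⟩ := hf
  exact Integrable.of_bound hf.aestronglyMeasurable C (ae_of_all _ hC)

end BddMeas

lemma integral_add_mul_add_mul {X : Type*} [MeasurableSpace X] {μ : Measure X} {f g h : X → ℝ}
    (hf : Integrable f μ) (hg : Integrable g μ) (hh : Integrable h μ) (a b : ℝ) :
    ∫ x, (f x + a * g x + b * h x) ∂μ =
      ∫ x, f x ∂μ + a * ∫ x, g x ∂μ + b * ∫ x, h x ∂μ := by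
  have h1 : Integrable (fun x => f x + a * g x) μ := hf.add (hg.const_mul a)
  rw [integral_add h1 (hh.const_mul b), integral_add hf (hg.const_mul a),
    integral_const_mul, integral_const_mul]

section Jump
variable {X : Type*} [MeasurableSpace X]

/-- The nonlocal diffusion operator `θ ↦ ∫ P(·,y) θ(y) dμ(y) - c θ`. -/
def jump (P : X → X → ℝ) (c : ℝ) (μ : Measure X) (θ : X → ℝ) (x : X) : ℝ :=
  (∫ y, P x y * θ y ∂μ) - c * θ x

/-- Symmetric, bounded, measurable jump kernels of total rate at most `c`. -/
structure IsJumpKernel (P : X → X → ℝ) (c : ℝ) (μ : Measure X) : Prop where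
  bddMeas : BddMeas (Function.uncurry P)
  nonneg : ∀ x y, 0 ≤ P x y
  symm : ∀ x y, P x y = P y x
  mass_le : ∀ x, ∫ y, P x y ∂μ ≤ c

variable {P : X → X → ℝ} {c : ℝ} {μ : Measure X}

lemma BddMeas.comp_fst {f : X → ℝ} (hf : BddMeas f) :
    BddMeas (fun p : X × X => f p.1) :=
  ⟨hf.1.comp measurable_fst, hf.2.imp fun _ h p => h p.1⟩

lemma BddMeas.comp_snd {f : X → ℝ} (hf : BddMeas f) :
    BddMeas (fun p : X × X => f p.2) :=
  ⟨hf.1.comp measurable_snd, hf.2.imp fun _ h p => h p.2⟩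

lemma BddMeas.section_right {F : X → X → ℝ} (hF : BddMeas (Function.uncurry F)) (x : X) :
    BddMeas (F x) :=
  ⟨hF.1.comp measurable_prodMk_left, hF.2.imp fun _ h y => h (x, y)⟩

lemma IsJumpKernel.bddMeas_mul (hP : IsJumpKernel P c μ) {F : X × X → ℝ} (hF : BddMeas F) :
    BddMeas (Function.uncurry fun x y => P x y * F (x, y)) :=
  hP.bddMeas.mul hF

variable [IsFiniteMeasure μ]

lemma BddMeas.integral_right {F : X → X → ℝ} (hF : BddMeas (Function.uncurry F)) :
    BddMeas (fun x => ∫ y, F x y ∂μ) := by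
  refine ⟨(hF.1.stronglyMeasurable.integral_prod_right).measurable, ?_⟩
  obtain ⟨C, hC⟩ := hF.2
  refine ⟨C * μ.real univ, fun x => ?_⟩
  simpa using norm_integral_le_of_norm_le_const (μ := μ) (f := F x) (C := C)
    (ae_of_all _ fun y => hC (x, y))

namespace IsJumpKernel

lemma bddMeas_jump (hP : IsJumpKernel P c μ) {θ : X → ℝ} (hθ : BddMeas θ) :
    BddMeas (jump P c μ θ) :=
  (BddMeas.integral_right (hP.bddMeas_mul hθ.comp_snd)).sub ((BddMeas.const c).mul hθ)

lemma integral_swap (hP : IsJumpKernel P c μ) {F : X × X → ℝ} (hF : BddMeas F) :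
    ∫ x, ∫ y, P x y * F (x, y) ∂μ ∂μ = ∫ x, ∫ y, P x y * F (y, x) ∂μ ∂μ := by
  rw [integral_integral_swap ((hP.bddMeas_mul hF).integrable (μ.prod μ))]
  simp_rw [hP.symm]

lemma integral_mul_jump (hP : IsJumpKernel P c μ) {f g : X → ℝ} (hf : BddMeas f)
    (hg : BddMeas g) :
    ∫ x, f x * jump P c μ g x ∂μ =
      (∫ x, ∫ y, P x y * (f x * g y) ∂μ ∂μ) - c * ∫ x, f x * g x ∂μ := by
  have h1 := (BddMeas.integral_right (μ := μ)
    (hP.bddMeas_mul (hf.comp_fst.mul hg.comp_snd))).integrable μ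
  have h2 := ((BddMeas.const c).mul (hf.mul hg)).integrable μ
  rw [← integral_const_mul, ← integral_sub h1 h2]
  refine integral_congr_ae (ae_of_all _ fun x => ?_)
  simp only [jump]
  rw [mul_sub, ← integral_const_mul]
  congr 1
  · exact integral_congr_ae (ae_of_all _ fun y => by ring)
  · ring

lemma integral_mul_jump_comm (hP : IsJumpKernel P c μ) {f g : X → ℝ} (hf : BddMeas f)
    (hg : BddMeas g) :
    ∫ x, f x * jump P c μ g x ∂μ = ∫ x, g x * jump P c μ f x ∂μ := by
  rw [hP.integral_mul_jump hf hg, hP.integral_mul_jump hg hf,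
    hP.integral_swap (hf.comp_fst.mul hg.comp_snd)]
  simp only [mul_comm (f _) (g _)]

lemma integral_sq_add (hP : IsJumpKernel P c μ) {f : X → ℝ} (hf : BddMeas f) (b : ℝ) :
    ∫ x, ∫ y, P x y * (f x + b * f y) ^ 2 ∂μ ∂μ =
      (1 + b ^ 2) * (∫ x, ∫ y, P x y * (f x * f x) ∂μ ∂μ) +
        2 * b * ∫ x, ∫ y, P x y * (f x * f y) ∂μ ∂μ := by
  have b1 := hP.bddMeas_mul (hf.comp_fst.mul hf.comp_fst)
  have b2 := hP.bddMeas_mul (hf.comp_snd.mul hf.comp_snd)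
  have b3 := hP.bddMeas_mul (hf.comp_fst.mul hf.comp_snd)
  have e1 := hP.integral_swap (hf.comp_fst.mul hf.comp_fst)
  have i1 := (BddMeas.integral_right (μ := μ) b1).integrable μ
  have i2 := (BddMeas.integral_right (μ := μ) b2).integrable μ
  have i3 := (BddMeas.integral_right (μ := μ) b3).integrable μ
  have key : ∀ x, ∫ y, P x y * (f x + b * f y) ^ 2 ∂μ =
      (∫ y, P x y * (f x * f x) ∂μ) + b ^ 2 * (∫ y, P x y * (f y * f y) ∂μ)
        + 2 * b * ∫ y, P x y * (f x * f y) ∂μ := by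
    intro x
    rw [← integral_add_mul_add_mul ((b1.section_right x).integrable μ)
      ((b2.section_right x).integrable μ) ((b3.section_right x).integrable μ)]
    refine integral_congr_ae (ae_of_all _ fun y => ?_)
    simp only
    ring
  simp_rw [key]
  rw [integral_add_mul_add_mul i1 i2 i3]
  simp only at e1 ⊢
  rw [← e1]
  ring

lemma integral_sq_le (hP : IsJumpKernel P c μ) {f : X → ℝ} (hf : BddMeas f) :
    ∫ x, ∫ y, P x y * (f x * f x) ∂μ ∂μ ≤ c * ∫ x, f x * f x ∂μ := by
  rw [← integral_const_mul]
  refine integral_mono ((BddMeas.integral_right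
    (hP.bddMeas_mul (hf.comp_fst.mul hf.comp_fst))).integrable μ)
    (((BddMeas.const c).mul (hf.mul hf)).integrable μ) fun x => ?_
  simp only
  rw [integral_mul_const]
  exact mul_le_mul_of_nonneg_right (hP.mass_le x) (mul_self_nonneg _)

lemma integral_mul_jump_self_nonpos (hP : IsJumpKernel P c μ) {f : X → ℝ} (hf : BddMeas f) :
    ∫ x, f x * jump P c μ f x ∂μ ≤ 0 := by
  have h := hP.integral_sq_add hf (-1)
  have h0 : 0 ≤ ∫ x, ∫ y, P x y * (f x + (-1) * f y) ^ 2 ∂μ ∂μ :=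
    integral_nonneg fun x => integral_nonneg fun y => mul_nonneg (hP.nonneg _ _) (sq_nonneg _)
  rw [hP.integral_mul_jump hf hf]
  linarith [hP.integral_sq_le hf]

lemma neg_integral_mul_jump_self_le (hP : IsJumpKernel P c μ) {f : X → ℝ} (hf : BddMeas f) :
    -∫ x, f x * jump P c μ f x ∂μ ≤ 2 * c * ∫ x, f x * f x ∂μ := by
  have h := hP.integral_sq_add hf 1
  have h0 : 0 ≤ ∫ x, ∫ y, P x y * (f x + 1 * f y) ^ 2 ∂μ ∂μ :=
    integral_nonneg fun x => integral_nonneg fun y => mul_nonneg (hP.nonneg _ _) (sq_nonneg _)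
  rw [hP.integral_mul_jump hf hf]
  linarith [hP.integral_sq_le hf]

/-- Energy bound for a function varying by at most `√d` along jumps that stay in the space. -/
lemma energy_le_of_sq_sub_le (hP : IsJumpKernel P c μ) {χ : X → ℝ} (hχ : BddMeas χ) {d : ℝ}
    (hmass : ∀ x, χ x ≠ 0 → ∫ y, P x y ∂μ = c) (hd : 0 ≤ d)
    (hvar : ∀ x y, P x y ≠ 0 → (χ x - χ y) ^ 2 ≤ d) :
    -∫ x, χ x * jump P c μ χ x ∂μ ≤ c * d / 2 * μ.real univ := by
  have h := hP.integral_sq_add hχ (-1)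
  have hc : ∫ x, ∫ y, P x y * (χ x * χ x) ∂μ ∂μ = c * ∫ x, χ x * χ x ∂μ := by
    rw [← integral_const_mul]
    refine integral_congr_ae (ae_of_all _ fun x => ?_)
    simp only
    rw [integral_mul_const]
    by_cases hx : χ x = 0
    · simp [hx]
    · rw [hmass x hx]
  have hle : ∫ x, ∫ y, P x y * (χ x + (-1) * χ y) ^ 2 ∂μ ∂μ ≤ c * d * μ.real univ := by
    have b1 := hP.bddMeas_mul ((hχ.comp_fst.add ((BddMeas.const (-1)).mul hχ.comp_snd)).mul
      (hχ.comp_fst.add ((BddMeas.const (-1)).mul hχ.comp_snd)))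
    simp only [← pow_two] at b1
    calc _ ≤ ∫ _x, c * d ∂μ := by
          refine integral_mono ((BddMeas.integral_right b1).integrable μ) (integrable_const _)
            fun x => ?_
          simp only
          calc _ ≤ ∫ y, P x y * d ∂μ := by
                refine integral_mono ((b1.section_right x).integrable μ)
                  (((hP.bddMeas.section_right x).integrable μ).mul_const d) fun y => ?_
                by_cases hxy : P x y = 0
                · simp [hxy]
                · have := hvar x y hxy
                  exact mul_le_mul_of_nonneg_left (by linarith [this, show χ x + -1 * χ y = χ x - χ y by ring, congrArg (· ^ 2) (show χ x + -1 * χ y = χ x - χ y by ring)]) (hP.nonneg _ _)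
            _ ≤ c * d := by
                rw [integral_mul_const]
                exact mul_le_mul_of_nonneg_right (hP.mass_le x) hd
      _ = _ := by simp [mul_comm]
  rw [hP.integral_mul_jump hχ hχ]
  linarith

end IsJumpKernel
end Jump

section DualScheme
variable {X : Type*} [MeasurableSpace X]

/-- Explicit Euler iterates for `θ' = a · jump θ`. -/
def dualSeq (P : X → X → ℝ) (c : ℝ) (μ : Measure X) (τ : ℝ) (a : ℕ → X → ℝ)
    (χ : X → ℝ) : ℕ → X → ℝ
  | 0 => χ
  | k + 1 => fun x => dualSeq P c μ τ a χ k x + τ * a k x * jump P c μ (dualSeq P c μ τ a χ k) x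

variable {P : X → X → ℝ} {c : ℝ} {μ : Measure X}

lemma IsJumpKernel.neg_mul_le_jump (hP : IsJumpKernel P c μ) {θ : X → ℝ} (h0 : ∀ x, 0 ≤ θ x) (x : X) :
    -(c * θ x) ≤ jump P c μ θ x := by
  have : 0 ≤ ∫ y, P x y * θ y ∂μ := integral_nonneg fun y => mul_nonneg (hP.nonneg _ _) (h0 y)
  simp only [jump]
  linarith

variable [IsFiniteMeasure μ]

namespace IsJumpKernel

lemma jump_mono (hP : IsJumpKernel P c μ) {θ : X → ℝ} (hθ : BddMeas θ) (h1 : ∀ x, θ x ≤ 1)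
    (x : X) : jump P c μ θ x ≤ c * (1 - θ x) := by
  have : ∫ y, P x y * θ y ∂μ ≤ ∫ y, P x y ∂μ :=
    integral_mono (((hP.bddMeas.section_right x).mul hθ).integrable μ)
      ((hP.bddMeas.section_right x).integrable μ)
      fun y => mul_le_of_le_one_right (hP.nonneg _ _) (h1 y)
  simp only [jump]
  linarith [hP.mass_le x]

lemma dualSeq_spec (hP : IsJumpKernel P c μ) {τ A : ℝ} {a : ℕ → X → ℝ} {χ : X → ℝ}
    (ha : ∀ k, BddMeas (a k)) (ha0 : ∀ k x, 0 ≤ a k x) (haA : ∀ k x, a k x ≤ A)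
    (hc : 0 ≤ c) (hτ : 0 ≤ τ) (hcfl : 2 * τ * c * A ≤ 1)
    (hχ : BddMeas χ) (hχ0 : ∀ x, 0 ≤ χ x) (hχ1 : ∀ x, χ x ≤ 1) (k : ℕ) :
    BddMeas (dualSeq P c μ τ a χ k) ∧ (∀ x, 0 ≤ dualSeq P c μ τ a χ k x) ∧
      ∀ x, dualSeq P c μ τ a χ k x ≤ 1 := by
  induction k with
  | zero => exact ⟨hχ, hχ0, hχ1⟩
  | succ k ih =>
    obtain ⟨hm, h0, h1⟩ := ih
    have hle : ∀ x, τ * a k x * c ≤ 1 := fun x => by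
      have := mul_le_mul_of_nonneg_left (haA k x) (mul_nonneg hτ hc)
      nlinarith [mul_nonneg (mul_nonneg hτ hc) (ha0 k x)]
    have hnn : ∀ x, 0 ≤ τ * a k x := fun x => mul_nonneg hτ (ha0 k x)
    refine ⟨hm.add (((BddMeas.const τ).mul (ha k)).mul (hP.bddMeas_jump hm)), fun x => ?_,
      fun x => ?_⟩
    · simp only [dualSeq]
      nlinarith [mul_le_mul_of_nonneg_left (hP.neg_mul_le_jump h0 x) (hnn x),
        mul_le_mul_of_nonneg_right (hle x) (h0 x)]
    · simp only [dualSeq]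
      nlinarith [mul_le_mul_of_nonneg_left (hP.jump_mono hm h1 x) (hnn x),
        mul_le_mul_of_nonneg_right (hle x) (sub_nonneg.2 (h1 x))]

lemma energy_step (hP : IsJumpKernel P c μ) {τ A : ℝ} {a θ : X → ℝ}
    (ha : BddMeas a) (ha0 : ∀ x, 0 ≤ a x) (haA : ∀ x, a x ≤ A)
    (hc : 0 ≤ c) (hτ : 0 ≤ τ) (hcfl : 2 * τ * c * A ≤ 1) (hθ : BddMeas θ) :
    τ * ∫ x, a x * (jump P c μ θ x * jump P c μ θ x) ∂μ ≤
      (∫ x, (θ x + τ * a x * jump P c μ θ x) *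
        jump P c μ (fun x => θ x + τ * a x * jump P c μ θ x) x ∂μ)
      - ∫ x, θ x * jump P c μ θ x ∂μ := by
  set q := jump P c μ θ with hq
  have hqm : BddMeas q := hP.bddMeas_jump hθ
  set f : X → ℝ := fun x => τ * a x * q x with hf
  have hfm : BddMeas f := ((BddMeas.const τ).mul ha).mul hqm
  have hjadd : ∀ x, jump P c μ (fun x => θ x + f x) x = q x + jump P c μ f x := by
    intro x
    simp only [jump, hq]
    have i1 := ((hP.bddMeas.section_right x).mul hθ).integrable μ
    have i2 := ((hP.bddMeas.section_right x).mul hfm).integrable μ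
    rw [show (fun y => P x y * (θ y + f y)) = fun y => P x y * θ y + P x y * f y by
      ext; ring, integral_add i1 i2]
    ring
  have hjf : BddMeas (jump P c μ f) := hP.bddMeas_jump hfm
  have e1 : ∫ x, (θ x + f x) * jump P c μ (fun x => θ x + f x) x ∂μ =
      ∫ x, θ x * q x ∂μ + 2 * ∫ x, f x * q x ∂μ + ∫ x, f x * jump P c μ f x ∂μ := by
    have hs : ∫ x, θ x * jump P c μ f x ∂μ = ∫ x, f x * q x ∂μ :=
      hP.integral_mul_jump_comm hθ hfm
    have h4 := integral_add_mul_add_mul ((hθ.mul hqm).integrable μ)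
      ((hfm.mul hqm).integrable μ) ((hfm.mul hjf).integrable μ) 1 1
    have h5 : Integrable (fun x => θ x * q x + 1 * (f x * q x) + 1 * (f x * jump P c μ f x)) μ :=
      (((hθ.mul hqm).add ((BddMeas.const 1).mul (hfm.mul hqm))).add
        ((BddMeas.const 1).mul (hfm.mul hjf))).integrable μ
    have h6 := integral_add h5 ((hθ.mul hjf).integrable μ)
    rw [h4, hs] at h6
    rw [integral_congr_ae (ae_of_all _ fun x => ?_), h6]
    · ring
    · simp only [hjadd x]
      ring
  have e2 : ∫ x, f x * q x ∂μ = τ * ∫ x, a x * (q x * q x) ∂μ := by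
    rw [← integral_const_mul]
    exact integral_congr_ae (ae_of_all _ fun x => by simp only [hf]; ring)
  have e3 : 2 * c * ∫ x, f x * f x ∂μ ≤ τ * ∫ x, a x * (q x * q x) ∂μ := by
    rw [← integral_const_mul, ← integral_const_mul]
    refine integral_mono (((BddMeas.const (2 * c)).mul (hfm.mul hfm)).integrable μ)
      (((BddMeas.const τ).mul (ha.mul (hqm.mul hqm))).integrable μ) fun x => ?_
    simp only [hf]
    have h7 : 2 * τ * c * a x ≤ 1 := by
      refine le_trans ?_ hcfl
      exact mul_le_mul_of_nonneg_left (haA x) (by positivity)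
    have h8 : 0 ≤ τ * (a x * (q x * q x)) :=
      mul_nonneg hτ (mul_nonneg (ha0 x) (mul_self_nonneg _))
    nlinarith [mul_le_mul_of_nonneg_right h7 h8]
  have e4 := hP.neg_integral_mul_jump_self_le hfm
  rw [e1]
  linarith

/-- Discrete duality estimate: a subsolution of a nonlocal inequality which starts nonpositive has
small pairing with every function `χ` of bounded energy, up to the reaction term. -/
theorem integral_mul_le_of_discrete_subsolution [Nonempty X] (hP : IsJumpKernel P c μ)
    {τ A K M E l : ℝ} {n : ℕ} {a z z' : ℕ → X → ℝ} {χ : X → ℝ}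
    (ha : ∀ k, BddMeas (a k)) (ha0 : ∀ k x, 0 ≤ a k x) (haA : ∀ k x, a k x ≤ A)
    (hc : 0 ≤ c) (hτ : 0 ≤ τ) (hK : 0 ≤ K) (hl : 0 < l) (hl1 : l ≤ 1)
    (hcfl : 2 * τ * c * (A + 1) ≤ 1)
    (hχ : BddMeas χ) (hχ0 : ∀ x, 0 ≤ χ x) (hχ1 : ∀ x, χ x ≤ 1)
    (hE : -∫ x, χ x * jump P c μ χ x ∂μ ≤ E)
    (hz : ∀ k, BddMeas (z k)) (hz' : ∀ k, BddMeas (z' k))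
    (hM : ∀ k ≤ n, ∀ x, |z k x| ≤ M) (hzz' : ∀ k ≤ n, ∀ x, |z' k x - z k x| ≤ l ^ 2)
    (hinit : ∀ x, z 0 x ≤ 0)
    (hsub : ∀ k < n, ∀ x, z' (k + 1) x - z' k x ≤
      τ * (jump P c μ (fun y => a k y * z k y) x + K * max (z k x) 0 + l ^ 2)) :
    ∫ x, z n x * χ x ∂μ ≤ K * ∑ k ∈ Finset.range n, τ * ∫ x, max (z k x) 0 ∂μ +
      l * ((A + 1 + M) * (E + n * τ * μ.real univ) / 2 + n * τ * μ.real univ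
        + 2 * μ.real univ) := by
  set m := μ.real univ with hm
  have hm0 : 0 ≤ m := measureReal_nonneg
  have hl2 : l ^ 2 ≤ l := by nlinarith
  obtain ⟨x₀⟩ := ‹Nonempty X›
  have hA0 : 0 ≤ A := (ha0 0 x₀).trans (haA 0 x₀)
  have hM0 : 0 ≤ M := (abs_nonneg _).trans (hM 0 (Nat.zero_le _) x₀)
  set a' : ℕ → X → ℝ := fun k x => a (n - 1 - k) x + l ^ 2 with ha'
  have ha'm : ∀ k, BddMeas (a' k) := fun k => (ha _).add (BddMeas.const _)
  have ha'0 : ∀ k x, 0 ≤ a' k x := fun k x => add_nonneg (ha0 _ _) (sq_nonneg _)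
  have ha'A : ∀ k x, a' k x ≤ A + 1 := fun k x => add_le_add (haA _ _) (by linarith)
  set ϑ := dualSeq P c μ τ a' χ with hϑ
  have hspec := hP.dualSeq_spec ha'm ha'0 ha'A hc hτ hcfl hχ hχ0 hχ1
  set q : ℕ → X → ℝ := fun k => jump P c μ (ϑ k) with hq
  have hqm : ∀ k, BddMeas (q k) := fun k => hP.bddMeas_jump (hspec k).1
  have hener : ∑ k ∈ Finset.range n, τ * ∫ x, q k x * q k x ∂μ ≤ E / l ^ 2 := by
    rw [le_div_iff₀ (by positivity)]
    have h1 : ∀ k, τ * (∫ x, q k x * q k x ∂μ) * l ^ 2 ≤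
        (∫ x, ϑ (k + 1) x * jump P c μ (ϑ (k + 1)) x ∂μ) -
          ∫ x, ϑ k x * jump P c μ (ϑ k) x ∂μ := by
      intro k
      refine le_trans ?_ (hP.energy_step (ha'm k) (ha'0 k) (ha'A k) hc hτ hcfl (hspec k).1)
      rw [mul_assoc]
      refine mul_le_mul_of_nonneg_left ?_ hτ
      rw [mul_comm, ← integral_const_mul]
      refine integral_mono (((BddMeas.const (l ^ 2)).mul ((hqm k).mul (hqm k))).integrable μ)
        (((ha'm k).mul ((hqm k).mul (hqm k))).integrable μ) fun x => ?_
      exact mul_le_mul_of_nonneg_right (by simp only [ha']; linarith [ha0 (n - 1 - k) x])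
        (mul_self_nonneg _)
    rw [Finset.sum_mul]
    refine (Finset.sum_le_sum fun k _ => h1 k).trans ?_
    rw [Finset.sum_range_sub (fun k => ∫ x, ϑ k x * jump P c μ (ϑ k) x ∂μ)]
    have := hP.integral_mul_jump_self_nonpos (hspec n).1
    simp only [hϑ, dualSeq] at this ⊢
    linarith
  have hqabs : ∑ k ∈ Finset.range n, τ * ∫ x, |q k x| ∂μ ≤ (E + n * τ * m) / (2 * l) := by
    have h1 : ∀ k, τ * ∫ x, |q k x| ∂μ ≤
        (l / 2) * (τ * ∫ x, q k x * q k x ∂μ) + τ * m / (2 * l) := by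
      intro k
      have : ∫ x, |q k x| ∂μ ≤ ∫ x, ((l / 2) * (q k x * q k x) + 1 / (2 * l)) ∂μ := by
        refine integral_mono ((hqm k).abs.integrable μ)
          ((((BddMeas.const _).mul ((hqm k).mul (hqm k))).add (BddMeas.const _)).integrable μ)
          fun x => ?_
        simp only
        rw [← abs_mul_abs_self (q k x)]
        have : l / 2 * (|q k x| * |q k x|) + 1 / (2 * l) - |q k x| =
          (l * |q k x| - 1) ^ 2 / (2 * l) := by field_simp; ring
        have h2 : 0 ≤ (l * |q k x| - 1) ^ 2 / (2 * l) := by positivity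
        linarith
      rw [integral_add (((BddMeas.const _).mul ((hqm k).mul (hqm k))).integrable μ)
        (integrable_const _), integral_const_mul, integral_const, smul_eq_mul] at this
      have := mul_le_mul_of_nonneg_left this hτ
      calc _ ≤ _ := this
        _ = _ := by rw [← hm]; ring
    refine (Finset.sum_le_sum fun k _ => h1 k).trans ?_
    rw [Finset.sum_add_distrib, ← Finset.mul_sum, Finset.sum_const, Finset.card_range,
      nsmul_eq_mul]
    have := mul_le_mul_of_nonneg_left hener (by positivity : 0 ≤ l / 2)
    calc _ ≤ l / 2 * (E / l ^ 2) + n * (τ * m / (2 * l)) := by linarith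
      _ = _ := by field_simp
  -- one time step, in the original direction of time
  have hstep : ∀ k < n, (∫ x, z' (k + 1) x * ϑ (n - (k + 1)) x ∂μ) - ∫ x, z' k x * ϑ (n - k) x ∂μ ≤
      K * (τ * ∫ x, max (z k x) 0 ∂μ) + τ * l ^ 2 * m +
        l ^ 2 * (A + 1 + M) * (τ * ∫ x, |q (n - (k + 1)) x| ∂μ) := by
    intro k hk
    obtain ⟨j, rfl⟩ : ∃ j, n = k + 1 + j := ⟨n - (k + 1), by omega⟩
    have e1 : k + 1 + j - (k + 1) = j := by omega
    have e2 : k + 1 + j - k = j + 1 := by omega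
    have e3 : k + 1 + j - 1 - j = k := by omega
    rw [e1, e2]
    have hϑs : ∀ x, ϑ (j + 1) x = ϑ j x + τ * (a k x + l ^ 2) * q j x := by
      intro x
      simp only [hϑ, dualSeq, ha', hq, e3]
    obtain ⟨hϑm, hϑ0, hϑ1⟩ := hspec j
    have hj1 := (hspec (j + 1)).1
    have hZ : BddMeas (fun y => a k y * z k y) := (ha k).mul (hz k)
    have hcomm := hP.integral_mul_jump_comm hϑm hZ
    have hJ := hP.bddMeas_jump hZ
    have bK : BddMeas (fun x => max (z k x) 0) := (hz k).max_zero
    rw [← integral_sub (((hz' (k + 1)).mul hϑm).integrable μ) (((hz' k).mul hj1).integrable μ)]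
    have bound : ∀ x, z' (k + 1) x * ϑ j x - z' k x * ϑ (j + 1) x ≤
        (τ * (ϑ j x * jump P c μ (fun y => a k y * z k y) x - a k x * z k x * q j x)) +
        (K * τ) * max (z k x) 0 + 1 * (τ * l ^ 2 +
          l ^ 2 * (A + 1 + M) * τ * |q j x|) := by
      intro x
      rw [hϑs]
      have h1 := mul_le_mul_of_nonneg_right (hsub k hk x) (hϑ0 x)
      have h2 : (a k x * z k x - z' k x * (a k x + l ^ 2)) * q j x ≤
          l ^ 2 * (A + 1 + M) * |q j x| := by
        have h3 : |a k x * z k x - z' k x * (a k x + l ^ 2)| ≤ l ^ 2 * (A + 1 + M) := by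
          rw [show a k x * z k x - z' k x * (a k x + l ^ 2) =
            -((z' k x - z k x) * (a k x + l ^ 2)) + -(l ^ 2 * z k x) by ring]
          refine (abs_add_le _ _).trans ?_
          rw [abs_neg, abs_neg, abs_mul, abs_mul, abs_of_nonneg (sq_nonneg l),
            abs_of_nonneg (add_nonneg (ha0 k x) (sq_nonneg l))]
          have h5 : a k x + l ^ 2 ≤ A + 1 := add_le_add (haA _ _) (by linarith)
          have h6 := mul_le_mul (hzz' k hk.le x) h5
            (add_nonneg (ha0 k x) (sq_nonneg l)) (sq_nonneg l)
          have h7 := mul_le_mul_of_nonneg_left (hM k hk.le x) (sq_nonneg l)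
          linarith
        calc _ ≤ |(a k x * z k x - z' k x * (a k x + l ^ 2)) * q j x| := le_abs_self _
          _ ≤ _ := by
            rw [abs_mul]
            exact mul_le_mul_of_nonneg_right h3 (abs_nonneg _)
      have h4 := mul_le_mul_of_nonneg_left h2 hτ
      have h5 : τ * (K * max (z k x) 0 + l ^ 2) * ϑ j x ≤ τ * (K * max (z k x) 0 + l ^ 2) :=
        mul_le_of_le_one_right (mul_nonneg hτ
          (add_nonneg (mul_nonneg hK (le_max_right _ _)) (sq_nonneg _))) (hϑ1 x)
      nlinarith [h1, h4, h5]
    have b1 : BddMeas (fun x => τ * (ϑ j x * jump P c μ (fun y => a k y * z k y) x -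
        a k x * z k x * q j x)) :=
      (BddMeas.const τ).mul ((hϑm.mul hJ).sub (hZ.mul (hqm j)))
    have b3 : BddMeas (fun x => τ * l ^ 2 + l ^ 2 * (A + 1 + M) * τ * |q j x|) :=
      (BddMeas.const _).add ((BddMeas.const _).mul (hqm j).abs)
    refine (integral_mono ((((hz' (k + 1)).mul hϑm).sub ((hz' k).mul hj1)).integrable μ)
      (((b1.add ((BddMeas.const _).mul bK)).add ((BddMeas.const _).mul b3)).integrable μ)
      bound).trans ?_
    have e4 : ∫ x, (τ * l ^ 2 + l ^ 2 * (A + 1 + M) * τ * |q j x|) ∂μ =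
        τ * l ^ 2 * m + l ^ 2 * (A + 1 + M) * τ * ∫ x, |q j x| ∂μ := by
      rw [integral_add (integrable_const _) (((BddMeas.const _).mul (hqm j).abs).integrable μ),
        integral_const, smul_eq_mul, ← hm, mul_comm m]
      exact congrArg _ (integral_const_mul _ _)
    have e5 : ∫ x, τ * (ϑ j x * jump P c μ (fun y => a k y * z k y) x -
        a k x * z k x * q j x) ∂μ = 0 := by
      rw [integral_const_mul, integral_sub ((hϑm.mul hJ).integrable μ)
        ((hZ.mul (hqm j)).integrable μ), sub_eq_zero.2 hcomm, mul_zero]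
    rw [integral_add_mul_add_mul (b1.integrable μ) (bK.integrable μ) (b3.integrable μ), e4, e5]
    apply le_of_eq
    ring
  have hsum := Finset.sum_le_sum fun k hk => hstep k (Finset.mem_range.1 hk)
  have hrefl : ∑ k ∈ Finset.range n, l ^ 2 * (A + 1 + M) * (τ * ∫ x, |q (n - (k + 1)) x| ∂μ) =
      l ^ 2 * (A + 1 + M) * ∑ k ∈ Finset.range n, τ * ∫ x, |q k x| ∂μ := by
    rw [← Finset.mul_sum, ← Finset.sum_range_reflect (fun j => τ * ∫ x, |q j x| ∂μ)]
    refine congrArg _ (Finset.sum_congr rfl fun k _ => ?_)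
    rw [show n - (k + 1) = n - 1 - k by omega]
  rw [Finset.sum_range_sub (fun k => ∫ x, z' k x * ϑ (n - k) x ∂μ), Finset.sum_add_distrib,
    Finset.sum_add_distrib, ← Finset.mul_sum, hrefl, Finset.sum_const, Finset.card_range,
    nsmul_eq_mul] at hsum
  simp only [Nat.sub_self, Nat.sub_zero] at hsum
  have hfin : ∫ x, z n x * χ x ∂μ ≤ (∫ x, z' n x * ϑ 0 x ∂μ) + l ^ 2 * m := by
    rw [show l ^ 2 * m = ∫ _x, l ^ 2 ∂μ by simp [hm, mul_comm], ← integral_add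
      (((hz' n).mul (hspec 0).1).integrable μ) (integrable_const _)]
    refine integral_mono (((hz n).mul hχ).integrable μ)
      ((((hz' n).mul (hspec 0).1).add (BddMeas.const _)).integrable μ) fun x => ?_
    have h1 := (abs_le.1 (hzz' n le_rfl x)).1
    simp only [dualSeq]
    nlinarith [hχ0 x, hχ1 x, sq_nonneg l, mul_le_mul_of_nonneg_right h1 (hχ0 x)]
  have hini : ∫ x, z' 0 x * ϑ n x ∂μ ≤ l ^ 2 * m := by
    rw [show l ^ 2 * m = ∫ _x, l ^ 2 ∂μ by simp [hm, mul_comm]]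
    refine integral_mono (((hz' 0).mul (hspec n).1).integrable μ) (integrable_const _) fun x => ?_
    have h1 := (abs_le.1 (hzz' 0 (Nat.zero_le _) x)).2
    have h2 := hinit x
    simp only
    nlinarith [(hspec n).2.1 x, (hspec n).2.2 x, sq_nonneg l,
      mul_le_mul_of_nonneg_right (show z' 0 x ≤ l ^ 2 by linarith) ((hspec n).2.1 x)]
  have herr := mul_le_mul_of_nonneg_left hqabs
    (by positivity : 0 ≤ l ^ 2 * (A + 1 + M))
  have herr' : l ^ 2 * (A + 1 + M) * ((E + n * τ * m) / (2 * l)) =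
      l * ((A + 1 + M) * (E + n * τ * m) / 2) := by field_simp
  have h9 : l ^ 2 * (n * τ * m) ≤ l * (n * τ * m) :=
    mul_le_mul_of_nonneg_right hl2 (by positivity)
  have h10 : l ^ 2 * m ≤ l * m := mul_le_mul_of_nonneg_right hl2 hm0
  rw [herr'] at herr
  linarith

end IsJumpKernel
end DualScheme

section Radial
variable {N : ℕ}

lemma hasFDerivAt_comp_norm_sub_sq {g : ℝ → ℝ} {d : ℝ} (x y : EuclideanSpace ℝ (Fin N))
    (h : HasDerivAt g d (‖y - x‖ ^ 2)) :
    HasFDerivAt (fun y => g (‖y - x‖ ^ 2)) (d • (2 • innerSL ℝ (y - x))) y := by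
  have h1 : HasFDerivAt (fun y : EuclideanSpace ℝ (Fin N) => ‖y - x‖ ^ 2)
      (2 • innerSL ℝ (y - x)) y := by
    simpa using ((hasFDerivAt_id y).sub_const x).norm_sq
  exact h.comp_hasFDerivAt y h1

lemma fderiv_radial_single {g g' : ℝ → ℝ} (h : ∀ s, HasDerivAt g (g' s) s)
    (x y : EuclideanSpace ℝ (Fin N)) (i : Fin N) :
    fderiv ℝ (fun y => g (‖y - x‖ ^ 2)) y (EuclideanSpace.single i (1 : ℝ)) =
      g' (‖y - x‖ ^ 2) * (2 * (y i - x i)) := by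
  rw [(hasFDerivAt_comp_norm_sub_sq x y (h _)).fderiv]
  simp [EuclideanSpace.inner_single_right]

/-- The Laplacian of a function of the squared distance to a point. -/
lemma lapl_radial {g g' g'' : ℝ → ℝ} (h : ∀ s, HasDerivAt g (g' s) s)
    (h' : ∀ s, HasDerivAt g' (g'' s) s) (x y : EuclideanSpace ℝ (Fin N)) :
    lapl (fun y => g (‖y - x‖ ^ 2)) y =
      2 * N * g' (‖y - x‖ ^ 2) + 4 * ‖y - x‖ ^ 2 * g'' (‖y - x‖ ^ 2) := by
  have key : ∀ i : Fin N, fderiv ℝ (fun y => fderiv ℝ (fun y => g (‖y - x‖ ^ 2)) y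
      (EuclideanSpace.single i (1 : ℝ))) y (EuclideanSpace.single i (1 : ℝ)) =
      2 * g' (‖y - x‖ ^ 2) + 4 * g'' (‖y - x‖ ^ 2) * (y i - x i) ^ 2 := by
    intro i
    simp_rw [fderiv_radial_single h x _ i]
    have h1 := hasFDerivAt_comp_norm_sub_sq x y (h' (‖y - x‖ ^ 2))
    have h2 : HasFDerivAt (fun y : EuclideanSpace ℝ (Fin N) => 2 * (y i - x i))
        ((2 : ℝ) • (EuclideanSpace.proj i : EuclideanSpace ℝ (Fin N) →L[ℝ] ℝ)) y :=
      (((EuclideanSpace.proj i : EuclideanSpace ℝ (Fin N) →L[ℝ] ℝ).hasFDerivAt).sub_const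
        (x i)).const_mul 2
    rw [(h1.fun_mul h2).fderiv]
    simp [EuclideanSpace.inner_single_right]
    ring
  simp only [lapl, key, Finset.sum_add_distrib, ← Finset.mul_sum, Finset.sum_const,
    Finset.card_univ, Fintype.card_fin, nsmul_eq_mul]
  rw [EuclideanSpace.norm_sq_eq]
  simp
  ring

end Radial

/-- A smooth nonincreasing radial profile of unit mass, supported in the unit ball. -/
structure IsProfile (N : ℕ) (κ : ℝ → ℝ) : Prop where
  contDiff : ContDiff ℝ (⊤ : ℕ∞) κ
  nonneg : ∀ s, 0 ≤ κ s
  deriv_nonpos : ∀ s, deriv κ s ≤ 0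
  eq_zero : ∀ s, 1 < s → κ s = 0
  integral_eq_one : ∫ y : EuclideanSpace ℝ (Fin N), κ (‖y‖ ^ 2) = 1

lemma exists_isProfile (N : ℕ) : ∃ κ, IsProfile N κ := by
  set f : ℝ → ℝ := fun s => expNegInvGlue (1 - s) with hf
  have hfs : ContDiff ℝ (⊤ : ℕ∞) f := expNegInvGlue.contDiff.comp (contDiff_const.sub contDiff_id)
  have hz : ∀ s, 1 ≤ s → f s = 0 := fun s hs => expNegInvGlue.zero_of_nonpos (by linarith)
  have hnn : ∀ s, 0 ≤ f s := fun s => expNegInvGlue.nonneg _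
  have hanti : Antitone f := fun a b hab => expNegInvGlue.monotone (by linarith)
  have hc : Continuous fun y : EuclideanSpace ℝ (Fin N) => f (‖y‖ ^ 2) :=
    hfs.continuous.comp (continuous_norm.pow 2)
  have hcs : HasCompactSupport fun y : EuclideanSpace ℝ (Fin N) => f (‖y‖ ^ 2) := by
    refine HasCompactSupport.intro (isCompact_closedBall 0 1) fun y hy => hz _ ?_
    simp only [Metric.mem_closedBall, dist_zero_right, not_le] at hy
    nlinarith
  have hpos : 0 < ∫ y : EuclideanSpace ℝ (Fin N), f (‖y‖ ^ 2) := by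
    refine hc.integral_pos_of_hasCompactSupport_nonneg_nonzero hcs (fun y => hnn _) (x := 0) ?_
    have : 0 < f (‖(0 : EuclideanSpace ℝ (Fin N))‖ ^ 2) := expNegInvGlue.pos_of_pos (by simp)
    exact this.ne'
  set I := ∫ y : EuclideanSpace ℝ (Fin N), f (‖y‖ ^ 2)
  refine ⟨fun s => I⁻¹ * f s, contDiff_const.mul hfs, fun s => mul_nonneg (by positivity) (hnn s),
    fun s => ?_, fun s hs => by simp [hz s hs.le], ?_⟩
  · have : Antitone fun s => I⁻¹ * f s := fun a b hab =>
      mul_le_mul_of_nonneg_left (hanti hab) (by positivity)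
    exact this.deriv_nonpos
  · rw [integral_const_mul, inv_mul_cancel₀ hpos.ne']

section Mollifier
variable {N : ℕ}

/-- The function `F(|·|²)` rescaled to the ball of radius `r` about `x`, preserving mass. -/
def rescale (F : ℝ → ℝ) (x : EuclideanSpace ℝ (Fin N)) (r : ℝ) (y : EuclideanSpace ℝ (Fin N)) : ℝ :=
  r ^ (-(N : ℤ)) * F (‖y - x‖ ^ 2 / r ^ 2)

lemma integral_rescale_mul (F : ℝ → ℝ) (V : EuclideanSpace ℝ (Fin N) → ℝ)
    (x : EuclideanSpace ℝ (Fin N)) {r : ℝ} (hr : 0 < r) :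
    ∫ y, rescale F x r y * V y = ∫ z, F (‖z‖ ^ 2) * V (x + r • z) := by
  set G : EuclideanSpace ℝ (Fin N) → ℝ := fun w => F (‖w‖ ^ 2 / r ^ 2) * V (x + w) with hG
  have h1 : ∀ z : EuclideanSpace ℝ (Fin N), F (‖z‖ ^ 2) * V (x + r • z) = G (r • z) := by
    intro z
    simp only [hG, norm_smul, Real.norm_eq_abs, mul_pow, sq_abs]
    rw [mul_div_cancel_left₀ _ (by positivity)]
  simp_rw [h1]
  rw [Measure.integral_comp_smul, ← integral_sub_right_eq_self G x, smul_eq_mul,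
    ← integral_const_mul]
  refine integral_congr_ae (ae_of_all _ fun y => ?_)
  simp only [hG, rescale, finrank_euclideanSpace, Fintype.card_fin, add_sub_cancel]
  rw [abs_of_pos (by positivity), zpow_neg, zpow_natCast, mul_assoc]

lemma rescale_eq_zero {F : ℝ → ℝ} (hF : ∀ s, 1 < s → F s = 0) {x y : EuclideanSpace ℝ (Fin N)}
    {r : ℝ} (hr : 0 < r) (hy : y ∉ Metric.closedBall x r) : rescale F x r y = 0 := by
  rw [rescale, hF, mul_zero]
  rw [Metric.mem_closedBall, not_le, dist_eq_norm] at hy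
  rw [one_lt_div (by positivity)]
  gcongr

lemma hasCompactSupport_rescale {F : ℝ → ℝ} (hF : ∀ s, 1 < s → F s = 0)
    (x : EuclideanSpace ℝ (Fin N)) {r : ℝ} (hr : 0 < r) : HasCompactSupport (rescale F x r) :=
  HasCompactSupport.intro (isCompact_closedBall x r) fun _ hy => rescale_eq_zero hF hr hy

lemma rescale_nonneg {F : ℝ → ℝ} (hF : ∀ s, 0 ≤ F s) (x : EuclideanSpace ℝ (Fin N)) {r : ℝ}
    (hr : 0 < r) (y : EuclideanSpace ℝ (Fin N)) : 0 ≤ rescale F x r y :=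
  mul_nonneg (by positivity) (hF _)

lemma continuous_rescale {F : ℝ → ℝ} (hF : Continuous F) (x : EuclideanSpace ℝ (Fin N)) (r : ℝ) :
    Continuous (rescale F x r) := by
  unfold rescale
  fun_prop

lemma rescale_comm (F : ℝ → ℝ) (x y : EuclideanSpace ℝ (Fin N)) (r : ℝ) :
    rescale F x r y = rescale F y r x := by
  rw [rescale, rescale, norm_sub_rev]

namespace IsProfile
variable {κ : ℝ → ℝ}

lemma differentiable (h : IsProfile N κ) : Differentiable ℝ κ :=
  h.contDiff.differentiable (by simp)

lemma contDiff_deriv (h : IsProfile N κ) : ContDiff ℝ (⊤ : ℕ∞) (deriv κ) :=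
  (contDiff_infty_iff_deriv.1 h.contDiff).2

lemma deriv_eq_zero (h : IsProfile N κ) (s : ℝ) (hs : 1 < s) : deriv κ s = 0 := by
  have : κ =ᶠ[nhds s] fun _ => 0 := by
    filter_upwards [Ioi_mem_nhds hs] with t ht using h.eq_zero t ht
  simp [this.deriv_eq]

lemma deriv_deriv_eq_zero (h : IsProfile N κ) (s : ℝ) (hs : 1 < s) : deriv (deriv κ) s = 0 := by
  have : deriv κ =ᶠ[nhds s] fun _ => 0 := by
    filter_upwards [Ioi_mem_nhds hs] with t ht using h.deriv_eq_zero t ht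
  simp [this.deriv_eq]

lemma contDiff_rescale (h : IsProfile N κ) (x : EuclideanSpace ℝ (Fin N)) (r : ℝ) :
    ContDiff ℝ (⊤ : ℕ∞) (rescale κ x r) := by
  unfold rescale
  exact contDiff_const.mul (h.contDiff.comp
    (((contDiff_norm_sq ℝ).comp (contDiff_id.sub contDiff_const)).div_const _))

lemma integral_rescale (h : IsProfile N κ) (x : EuclideanSpace ℝ (Fin N)) {r : ℝ} (hr : 0 < r) :
    ∫ y, rescale κ x r y = 1 := by
  simpa [h.integral_eq_one] using integral_rescale_mul κ (fun _ => 1) x hr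

lemma lapl_rescale (h : IsProfile N κ) (x y : EuclideanSpace ℝ (Fin N)) (r : ℝ) :
    lapl (rescale κ x r) y = r ^ (-(N : ℤ)) * (2 * N * deriv κ (‖y - x‖ ^ 2 / r ^ 2) / r ^ 2 +
      4 * ‖y - x‖ ^ 2 * deriv (deriv κ) (‖y - x‖ ^ 2 / r ^ 2) / r ^ 4) := by
  have hd : ∀ s, HasDerivAt (fun s : ℝ => s / r ^ 2) (1 / r ^ 2) s := fun s =>
    (hasDerivAt_id s).div_const _
  have h1 : ∀ s, HasDerivAt (fun s => r ^ (-(N : ℤ)) * κ (s / r ^ 2))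
      (r ^ (-(N : ℤ)) * (deriv κ (s / r ^ 2) * (1 / r ^ 2))) s := fun s =>
    ((h.differentiable _).hasDerivAt.comp s (hd s)).const_mul _
  have h2 : ∀ s, HasDerivAt (fun s => r ^ (-(N : ℤ)) * (deriv κ (s / r ^ 2) * (1 / r ^ 2)))
      (r ^ (-(N : ℤ)) * (deriv (deriv κ) (s / r ^ 2) * (1 / r ^ 2) * (1 / r ^ 2))) s := fun s =>
    ((((h.contDiff_deriv.differentiable (by simp)) _).hasDerivAt.comp s (hd s)).mul_const
      _).const_mul _
  have := lapl_radial h1 h2 x y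
  rw [show rescale κ x r = fun y => r ^ (-(N : ℤ)) * κ (‖y - x‖ ^ 2 / r ^ 2) from rfl, this]
  ring

lemma hasDerivAt_rescale (h : IsProfile N κ) (x y : EuclideanSpace ℝ (Fin N)) {r : ℝ}
    (hr : 0 < r) :
    HasDerivAt (fun r => rescale (fun s => -deriv κ s) x r y)
      (r / 2 * lapl (rescale κ x r) y) r := by
  have h1 := hasDerivAt_zpow (-(N : ℤ)) r (Or.inl hr.ne')
  have h2 : HasDerivAt (fun r : ℝ => ‖y - x‖ ^ 2 / r ^ 2) (-(2 * ‖y - x‖ ^ 2 / r ^ 3)) r := by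
    refine ((hasDerivAt_const r (‖y - x‖ ^ 2)).fun_div (hasDerivAt_pow 2 r)
      (by positivity)).congr_deriv ?_
    field_simp
    simp
    ring
  have h3 := (((h.contDiff_deriv.differentiable (by simp))
    (‖y - x‖ ^ 2 / r ^ 2)).hasDerivAt.comp r h2).neg
  refine (h1.mul h3).congr_deriv ?_
  rw [lapl_rescale h, zpow_sub_one₀ hr.ne']
  simp only [Function.comp_apply, Pi.neg_apply]
  push_cast
  field_simp
  ring

end IsProfile
end Mollifier

section Steklov
variable {N : ℕ}

lemma continuous_integral_dilate {F : ℝ → ℝ} (hF : Continuous F) (hF0 : ∀ s, 1 < s → F s = 0)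
    {V : EuclideanSpace ℝ (Fin N) → ℝ} (hV : Continuous V) :
    Continuous fun p : EuclideanSpace ℝ (Fin N) × ℝ => ∫ z, F (‖z‖ ^ 2) * V (p.1 + p.2 • z) := by
  rw [← continuousOn_univ]
  refine continuousOn_integral_of_compact_support
    (isCompact_closedBall (0 : EuclideanSpace ℝ (Fin N)) 1) ?_ ?_
  · apply Continuous.continuousOn
    simp only [Function.uncurry_def]
    fun_prop
  · intro p z _ hz
    rw [hF0, zero_mul]
    simp only [Metric.mem_closedBall, dist_zero_right, not_le] at hz
    nlinarith

/-- A weighted average of `V` near `x` at scales up to `h`. -/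
def steklov (κ : ℝ → ℝ) (h : ℝ) (V : EuclideanSpace ℝ (Fin N) → ℝ)
    (x : EuclideanSpace ℝ (Fin N)) : ℝ :=
  2 / h ^ 2 * ∫ r in (0 : ℝ)..h, r * ∫ z : EuclideanSpace ℝ (Fin N), κ (‖z‖ ^ 2) * V (x + r • z)

namespace IsProfile
variable {κ : ℝ → ℝ}

lemma continuous_lapl_rescale (h : IsProfile N κ) (x : EuclideanSpace ℝ (Fin N)) :
    ContinuousOn (fun p : ℝ × EuclideanSpace ℝ (Fin N) => lapl (rescale κ x p.1) p.2)
      (Ioi 0 ×ˢ univ) := by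
  simp_rw [h.lapl_rescale]
  have h1 := h.contDiff_deriv.continuous
  have h2 := (contDiff_infty_iff_deriv.1 h.contDiff_deriv).2.continuous
  have hne : ∀ p ∈ (Ioi (0 : ℝ)) ×ˢ (univ : Set (EuclideanSpace ℝ (Fin N))), p.1 ≠ 0 :=
    fun p hp => ne_of_gt hp.1
  have hS : ContinuousOn (fun p : ℝ × EuclideanSpace ℝ (Fin N) => ‖p.2 - x‖ ^ 2 / p.1 ^ 2)
      (Ioi 0 ×ˢ univ) :=
    ContinuousOn.div (by fun_prop) (by fun_prop) fun p hp => pow_ne_zero _ (hne p hp)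
  refine ContinuousOn.mul ?_ (ContinuousOn.add (ContinuousOn.div ?_ (by fun_prop) ?_)
    (ContinuousOn.div ?_ (by fun_prop) ?_))
  · exact continuousOn_fst.zpow₀ _ fun p hp => Or.inl (hne p hp)
  · exact continuousOn_const.mul (h1.comp_continuousOn hS)
  · exact fun p hp => pow_ne_zero _ (hne p hp)
  · exact ContinuousOn.mul (by fun_prop) (h2.comp_continuousOn hS)
  · exact fun p hp => pow_ne_zero _ (hne p hp)

lemma lapl_rescale_eq_zero (h : IsProfile N κ) {x y : EuclideanSpace ℝ (Fin N)} {r : ℝ}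
    (hr : 0 < r) (hy : y ∉ Metric.closedBall x r) : lapl (rescale κ x r) y = 0 := by
  have : 1 < ‖y - x‖ ^ 2 / r ^ 2 := by
    rw [Metric.mem_closedBall, not_le, dist_eq_norm] at hy
    rw [one_lt_div (by positivity)]
    gcongr
  rw [h.lapl_rescale, h.deriv_eq_zero _ this, h.deriv_deriv_eq_zero _ this]
  simp

lemma hasDerivAt_integral_rescale (h : IsProfile N κ) {V : EuclideanSpace ℝ (Fin N) → ℝ}
    (hV : Continuous V) (x : EuclideanSpace ℝ (Fin N)) {r : ℝ} (hr : 0 < r) :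
    HasDerivAt (fun r => ∫ y, rescale (fun s => -deriv κ s) x r y * V y)
      (r / 2 * ∫ y, V y * lapl (rescale κ x r) y) r := by
  have hj : Continuous fun s => -deriv κ s := h.contDiff_deriv.continuous.neg
  have hj0 : ∀ s, 1 < s → -deriv κ s = 0 := fun s hs => by simp [h.deriv_eq_zero s hs]
  have hcont : ContinuousOn (fun p : ℝ × EuclideanSpace ℝ (Fin N) =>
      p.1 / 2 * lapl (rescale κ x p.1) p.2 * V p.2) (Ioi 0 ×ˢ univ) :=
    ((continuousOn_fst.div_const 2).mul (h.continuous_lapl_rescale x)).mul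
      (hV.comp continuous_snd).continuousOn
  have hK : IsCompact (Icc (r / 2) (2 * r) ×ˢ Metric.closedBall x (2 * r)) :=
    isCompact_Icc.prod (isCompact_closedBall _ _)
  obtain ⟨C, hC⟩ := hK.exists_bound_of_continuousOn (hcont.mono (prod_mono
    (fun s hs => lt_of_lt_of_le (by positivity : 0 < r / 2) hs.1) (subset_univ _)))
  have hmeas : ∀ s > 0, Continuous fun y => s / 2 * lapl (rescale κ x s) y * V y := fun s hs =>
    continuousOn_univ.1 <| hcont.comp (f := fun y => (s, y)) (by fun_prop)
      fun y _ => ⟨hs, mem_univ y⟩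
  have key := hasDerivAt_integral_of_dominated_loc_of_deriv_le (μ := volume) (x₀ := r)
    (s := Icc (r / 2) (2 * r))
    (F := fun r y => rescale (fun s => -deriv κ s) x r y * V y)
    (F' := fun s y => s / 2 * lapl (rescale κ x s) y * V y)
    (bound := (Metric.closedBall x (2 * r)).indicator fun _ => C)
    (Icc_mem_nhds (by linarith) (by linarith))
    (Eventually.of_forall fun s => ((continuous_rescale hj x s).mul hV).aestronglyMeasurable)
    (((continuous_rescale hj x r).mul hV).integrable_of_hasCompactSupport
      (hasCompactSupport_rescale hj0 x hr).mul_right)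
    (hmeas r hr).aestronglyMeasurable
    (ae_of_all _ fun y s hs => ?_)
    ((integrable_indicator_iff measurableSet_closedBall).2
      (integrableOn_const (isCompact_closedBall _ _).measure_ne_top))
    (ae_of_all _ fun y s hs => (h.hasDerivAt_rescale x y
      (lt_of_lt_of_le (by positivity) hs.1)).mul_const _)
  · refine key.2.congr_deriv ?_
    rw [← integral_const_mul]
    exact integral_congr_ae (ae_of_all _ fun y => by ring)
  · by_cases hy : y ∈ Metric.closedBall x (2 * r)
    · rw [indicator_of_mem hy]
      exact hC (s, y) ⟨hs, hy⟩
    · rw [indicator_of_notMem hy, h.lapl_rescale_eq_zero (lt_of_lt_of_le (by positivity) hs.1)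
        fun hy' => hy (Metric.closedBall_subset_closedBall hs.2 hy')]
      simp

/-- Smoothed form of the distributional inequality `D ≤ ΔV + Φ`. -/
theorem steklov_le (h : IsProfile N κ) {D V Φ : EuclideanSpace ℝ (Fin N) → ℝ}
    (hD : Continuous D) (hV : Continuous V) (hΦ : Continuous Φ)
    (hsub : ∀ η : EuclideanSpace ℝ (Fin N) → ℝ, ContDiff ℝ (⊤ : ℕ∞) η → HasCompactSupport η →
      (∀ y, 0 ≤ η y) → ∫ y, D y * η y ≤ (∫ y, V y * lapl η y) + ∫ y, Φ y * η y)
    {x : EuclideanSpace ℝ (Fin N)} {ε c₀ : ℝ} (hε : 0 < ε)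
    (hc₀ : ∀ y ∈ Metric.closedBall x ε, Φ y ≤ c₀) :
    steklov κ ε D x ≤ 4 / ε ^ 2 * ((∫ y, rescale (fun s => -deriv κ s) x ε y * V y) -
      (∫ z : EuclideanSpace ℝ (Fin N), -deriv κ (‖z‖ ^ 2)) * V x) + c₀ := by
  have hj : Continuous fun s => -deriv κ s := h.contDiff_deriv.continuous.neg
  have hj0 : ∀ s, 1 < s → -deriv κ s = 0 := fun s hs => by simp [h.deriv_eq_zero s hs]
  set d : ℝ → ℝ := fun r => ∫ z, κ (‖z‖ ^ 2) * D (x + r • z) with hd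
  have hdc : Continuous d := (continuous_integral_dilate h.contDiff.continuous h.eq_zero hD).comp
    (continuous_const.prodMk continuous_id)
  set f : ℝ → ℝ := fun r => ∫ z, -deriv κ (‖z‖ ^ 2) * V (x + r • z) with hf
  have hfc : Continuous f := (continuous_integral_dilate hj hj0 hV).comp
    (continuous_const.prodMk continuous_id)
  have hfd : ∀ r > 0, HasDerivAt f (r / 2 * ∫ y, V y * lapl (rescale κ x r) y) r := by
    intro r hr
    refine (h.hasDerivAt_integral_rescale hV x hr).congr_of_eventuallyEq ?_
    filter_upwards [Ioi_mem_nhds hr] with s hs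
    exact (integral_rescale_mul (fun s => -deriv κ s) V x hs).symm
  set G : ℝ → ℝ := fun r => (∫ ρ in (0 : ℝ)..r, ρ * d ρ) - 2 * f r - c₀ * r ^ 2 / 2 with hG
  have hGd : ∀ r > 0, HasDerivAt G (r * d r - 2 * (r / 2 * ∫ y, V y * lapl (rescale κ x r) y)
      - c₀ * r) r := by
    intro r hr
    have h1 : HasDerivAt (fun r => ∫ ρ in (0 : ℝ)..r, ρ * d ρ) (r * d r) r :=
      intervalIntegral.integral_hasDerivAt_right
        ((continuous_id.mul hdc).intervalIntegrable _ _)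
        ((continuous_id.mul hdc).stronglyMeasurableAtFilter _ _) (continuous_id.mul hdc).continuousAt
    have h2 : HasDerivAt (fun r : ℝ => c₀ * r ^ 2 / 2) (c₀ * r) r := by
      refine (((hasDerivAt_pow 2 r).const_mul c₀).div_const 2).congr_deriv ?_
      simp
      ring
    exact (h1.sub ((hfd r hr).const_mul 2)).sub h2
  have hGc : Continuous G := by
    have : Continuous fun r => ∫ ρ in (0 : ℝ)..r, ρ * d ρ :=
      intervalIntegral.continuous_primitive (fun a b =>
        (continuous_id.mul hdc).intervalIntegrable a b) 0
    fun_prop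
  have hle : ∀ r ∈ Ioo 0 ε, d r ≤ (∫ y, V y * lapl (rescale κ x r) y) + c₀ := by
    intro r hr
    have h1 := hsub _ (h.contDiff_rescale x r) (hasCompactSupport_rescale h.eq_zero x hr.1)
      (rescale_nonneg h.nonneg x hr.1)
    have hrc := continuous_rescale h.contDiff.continuous x r
    have hrs := hasCompactSupport_rescale h.eq_zero x hr.1
    have h2 : ∫ y, Φ y * rescale κ x r y ≤ ∫ y, c₀ * rescale κ x r y := by
      refine integral_mono ((hΦ.mul hrc).integrable_of_hasCompactSupport hrs.mul_left)
        ((continuous_const.mul hrc).integrable_of_hasCompactSupport hrs.mul_left) fun y => ?_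
      by_cases hy : y ∈ Metric.closedBall x r
      · exact mul_le_mul_of_nonneg_right
          (hc₀ y (Metric.closedBall_subset_closedBall hr.2.le hy))
          (rescale_nonneg h.nonneg x hr.1 y)
      · simp [rescale_eq_zero h.eq_zero hr.1 hy]
    rw [integral_const_mul, h.integral_rescale x hr.1, mul_one] at h2
    have h3 : d r = ∫ y, D y * rescale κ x r y := by
      refine (integral_rescale_mul κ D x hr.1).symm.trans ?_
      simp only [mul_comm]
    linarith
  have hmono : AntitoneOn G (Icc 0 ε) := by
    refine antitoneOn_of_deriv_nonpos (convex_Icc _ _) hGc.continuousOn ?_ ?_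
    · rw [interior_Icc]
      exact fun r hr => (hGd r hr.1).differentiableAt.differentiableWithinAt
    · rw [interior_Icc]
      intro r hr
      rw [(hGd r hr.1).deriv]
      nlinarith [mul_le_mul_of_nonneg_left (hle r hr) hr.1.le]
  have hfin := hmono (left_mem_Icc.2 hε.le) (right_mem_Icc.2 hε.le) hε.le
  have hf0 : f 0 = (∫ z : EuclideanSpace ℝ (Fin N), -deriv κ (‖z‖ ^ 2)) * V x := by
    simp only [hf, zero_smul, add_zero]
    rw [integral_mul_const]
  simp only [hG, intervalIntegral.integral_same] at hfin
  rw [integral_rescale_mul _ V x hε, ← hf0, steklov]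
  change 2 / ε ^ 2 * (∫ r in (0 : ℝ)..ε, r * d r) ≤ 4 / ε ^ 2 * (f ε - f 0) + c₀
  have h4 : ∫ r in (0 : ℝ)..ε, r * d r ≤ 2 * (f ε - f 0) + c₀ * ε ^ 2 / 2 := by
    linarith
  calc _ ≤ 2 / ε ^ 2 * (2 * (f ε - f 0) + c₀ * ε ^ 2 / 2) :=
        mul_le_mul_of_nonneg_left h4 (by positivity)
    _ = _ := by
      field_simp
      ring

end IsProfile
end Steklov

section SteklovKernel
variable {N : ℕ} {κ : ℝ → ℝ}

namespace IsProfile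

lemma continuous_steklov (h : IsProfile N κ) (ε : ℝ) {V : EuclideanSpace ℝ (Fin N) → ℝ}
    (hV : Continuous V) : Continuous (steklov κ ε V) := by
  unfold steklov
  refine continuous_const.mul (intervalIntegral.continuous_parametric_intervalIntegral_of_continuous'
    (f := fun x r => r * ∫ z : EuclideanSpace ℝ (Fin N), κ (‖z‖ ^ 2) * V (x + r • z)) ?_ 0 ε)
  exact continuous_snd.mul (continuous_integral_dilate h.contDiff.continuous h.eq_zero hV)

lemma integrable_mul_dilate (h : IsProfile N κ) {V : EuclideanSpace ℝ (Fin N) → ℝ}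
    (hV : Continuous V) (x : EuclideanSpace ℝ (Fin N)) (r : ℝ) :
    Integrable fun z : EuclideanSpace ℝ (Fin N) => κ (‖z‖ ^ 2) * V (x + r • z) := by
  refine Continuous.integrable_of_hasCompactSupport ?_ (HasCompactSupport.intro
    (isCompact_closedBall 0 1) fun z hz => ?_)
  · have := h.contDiff.continuous
    fun_prop
  · rw [h.eq_zero, zero_mul]
    simp only [Metric.mem_closedBall, dist_zero_right, not_le] at hz
    nlinarith

lemma intervalIntegrable_mul_dilate (h : IsProfile N κ) {V : EuclideanSpace ℝ (Fin N) → ℝ}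
    (hV : Continuous V) (x : EuclideanSpace ℝ (Fin N)) (a b : ℝ) :
    IntervalIntegrable (fun r : ℝ => r * ∫ z : EuclideanSpace ℝ (Fin N),
      κ (‖z‖ ^ 2) * V (x + r • z)) volume a b :=
  (continuous_id.mul ((continuous_integral_dilate h.contDiff.continuous h.eq_zero hV).comp
    (continuous_const.prodMk continuous_id))).intervalIntegrable a b

lemma steklov_sub (h : IsProfile N κ) (ε : ℝ) {V W : EuclideanSpace ℝ (Fin N) → ℝ}
    (hV : Continuous V) (hW : Continuous W) (x : EuclideanSpace ℝ (Fin N)) :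
    steklov κ ε (fun y => V y - W y) x = steklov κ ε V x - steklov κ ε W x := by
  unfold steklov
  rw [← mul_sub, ← intervalIntegral.integral_sub (h.intervalIntegrable_mul_dilate hV x 0 ε)
    (h.intervalIntegrable_mul_dilate hW x 0 ε)]
  congr 1
  refine intervalIntegral.integral_congr fun r _ => ?_
  simp only
  rw [← mul_sub, ← integral_sub (h.integrable_mul_dilate hV x r) (h.integrable_mul_dilate hW x r)]
  simp only [mul_sub]

lemma steklov_const (h : IsProfile N κ) {ε : ℝ} (hε : 0 < ε) (b : ℝ)
    (x : EuclideanSpace ℝ (Fin N)) : steklov κ ε (fun _ => b) x = b := by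
  simp only [steklov, integral_mul_const, h.integral_eq_one, one_mul,
    intervalIntegral.integral_mul_const, integral_id]
  field_simp
  ring

lemma steklov_mono (h : IsProfile N κ) {ε : ℝ} (hε : 0 < ε) {V W : EuclideanSpace ℝ (Fin N) → ℝ}
    (hV : Continuous V) (hW : Continuous W) {x : EuclideanSpace ℝ (Fin N)}
    (hVW : ∀ y ∈ Metric.closedBall x ε, V y ≤ W y) : steklov κ ε V x ≤ steklov κ ε W x := by
  refine mul_le_mul_of_nonneg_left ?_ (by positivity)
  refine intervalIntegral.integral_mono_on hε.le (h.intervalIntegrable_mul_dilate hV x 0 ε)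
    (h.intervalIntegrable_mul_dilate hW x 0 ε) fun r hr => ?_
  refine mul_le_mul_of_nonneg_left ?_ hr.1
  refine integral_mono (h.integrable_mul_dilate hV x r) (h.integrable_mul_dilate hW x r) fun z => ?_
  by_cases hz : 1 < ‖z‖ ^ 2
  · simp [h.eq_zero _ hz]
  · refine mul_le_mul_of_nonneg_left (hVW _ ?_) (h.nonneg _)
    have hz1 : ‖z‖ ≤ 1 := by nlinarith [norm_nonneg z]
    rw [Metric.mem_closedBall, dist_eq_norm, add_sub_cancel_left, norm_smul, Real.norm_eq_abs,
      abs_of_nonneg hr.1]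
    nlinarith [hr.1, hr.2, norm_nonneg z]

lemma abs_steklov_sub_le (h : IsProfile N κ) {ε d : ℝ} (hε : 0 < ε)
    {V : EuclideanSpace ℝ (Fin N) → ℝ} (hV : Continuous V) {x : EuclideanSpace ℝ (Fin N)}
    (hd : ∀ y ∈ Metric.closedBall x ε, |V y - V x| ≤ d) : |steklov κ ε V x - V x| ≤ d := by
  have h1 := h.steklov_mono hε hV continuous_const (W := fun _ => V x + d) (x := x)
    fun y hy => by linarith [(abs_le.1 (hd y hy)).2]
  have h2 := h.steklov_mono hε continuous_const hV (V := fun _ => V x - d) (x := x)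
    fun y hy => by linarith [(abs_le.1 (hd y hy)).1]
  rw [h.steklov_const hε] at h1 h2
  rw [abs_le]
  constructor <;> linarith

/-- The jump kernel at scale `ε` associated with a radial profile. -/
def kernel (_ : IsProfile N κ) (ε : ℝ) (x y : EuclideanSpace ℝ (Fin N)) : ℝ :=
  4 / ε ^ 2 * rescale (fun s => -deriv κ s) x ε y

/-- The total mass of the unscaled jump kernel. -/
def mass (_ : IsProfile N κ) : ℝ := ∫ z : EuclideanSpace ℝ (Fin N), -deriv κ (‖z‖ ^ 2)

lemma mass_nonneg (h : IsProfile N κ) : 0 ≤ h.mass :=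
  integral_nonneg fun _ => neg_nonneg.2 (h.deriv_nonpos _)

lemma kernel_nonneg (h : IsProfile N κ) {ε : ℝ} (hε : 0 < ε) (x y : EuclideanSpace ℝ (Fin N)) :
    0 ≤ h.kernel ε x y :=
  mul_nonneg (by positivity)
    (rescale_nonneg (fun s => neg_nonneg.2 (h.deriv_nonpos s)) x hε y)

lemma kernel_eq_zero (h : IsProfile N κ) {ε : ℝ} (hε : 0 < ε) {x y : EuclideanSpace ℝ (Fin N)}
    (hy : y ∉ Metric.closedBall x ε) : h.kernel ε x y = 0 := by
  rw [kernel, rescale_eq_zero (fun s hs => by simp [h.deriv_eq_zero s hs]) hε hy, mul_zero]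

lemma continuous_kernel (h : IsProfile N κ) (ε : ℝ) :
    Continuous (Function.uncurry (h.kernel ε)) := by
  have := h.contDiff_deriv.continuous
  simp only [kernel, rescale, Function.uncurry_def]
  fun_prop

lemma integrable_kernel_mul (h : IsProfile N κ) {ε : ℝ} (hε : 0 < ε)
    (x : EuclideanSpace ℝ (Fin N)) {V : EuclideanSpace ℝ (Fin N) → ℝ} (hV : Continuous V) :
    Integrable fun y => h.kernel ε x y * V y :=
  (((h.continuous_kernel ε).comp (Continuous.prodMk_right x)).mul
    hV).integrable_of_hasCompactSupport (HasCompactSupport.intro (isCompact_closedBall x ε)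
      fun y hy => by
        change h.kernel ε x y * V y = 0
        rw [h.kernel_eq_zero hε hy, zero_mul])

lemma integral_kernel (h : IsProfile N κ) {ε : ℝ} (hε : 0 < ε) (x : EuclideanSpace ℝ (Fin N)) :
    ∫ y, h.kernel ε x y = 4 / ε ^ 2 * h.mass := by
  have := integral_rescale_mul (fun s => -deriv κ s) (fun _ => 1) x hε
  simp only [mul_one] at this
  simp only [kernel, integral_const_mul, this, mass]

lemma isJumpKernel (h : IsProfile N κ) {ε : ℝ} (hε : 0 < ε) (S : Set (EuclideanSpace ℝ (Fin N))) :
    IsJumpKernel (h.kernel ε) (4 / ε ^ 2 * h.mass) (volume.restrict S) where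
  bddMeas := by
    refine ⟨(h.continuous_kernel ε).measurable, ?_⟩
    obtain ⟨C, hC⟩ := (isCompact_Icc (a := (0 : ℝ)) (b := 1)).exists_bound_of_continuousOn
      h.contDiff_deriv.continuous.continuousOn
    refine ⟨4 / ε ^ 2 * (ε ^ (-(N : ℤ)) * C), fun p => ?_⟩
    have hC0 : 0 ≤ C := (norm_nonneg _).trans (hC 0 (by simp))
    simp only [Function.uncurry_def, kernel, rescale]
    rw [abs_mul, abs_mul, abs_of_nonneg (by positivity : 0 ≤ 4 / ε ^ 2),
      abs_of_nonneg (by positivity : 0 ≤ ε ^ (-(N : ℤ))), abs_neg]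
    gcongr
    by_cases hs : 1 < ‖p.2 - p.1‖ ^ 2 / ε ^ 2
    · simpa [h.deriv_eq_zero _ hs] using hC0
    · exact hC _ ⟨by positivity, not_lt.1 hs⟩
  nonneg := h.kernel_nonneg hε
  symm x y := by rw [kernel, kernel, rescale_comm]
  mass_le x := by
    rw [← h.integral_kernel hε x]
    have := h.integrable_kernel_mul hε x (V := fun _ => 1) continuous_const
    simp only [mul_one] at this
    exact setIntegral_le_integral this (ae_of_all _ (h.kernel_nonneg hε x))

lemma setIntegral_kernel_eq (h : IsProfile N κ) {ε : ℝ} (hε : 0 < ε)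
    {S : Set (EuclideanSpace ℝ (Fin N))} {x : EuclideanSpace ℝ (Fin N)}
    (hx : Metric.closedBall x ε ⊆ S) : ∫ y in S, h.kernel ε x y = 4 / ε ^ 2 * h.mass := by
  rw [← h.integral_kernel hε x]
  exact setIntegral_eq_integral_of_forall_compl_eq_zero fun y hy =>
    h.kernel_eq_zero hε fun hy' => hy (hx hy')

/-- Smoothed form of `D ≤ ΔV + Φ`, with the diffusion confined to a set outside which `V ≤ 0`. -/
lemma steklov_le_jump (h : IsProfile N κ) {D V Φ : EuclideanSpace ℝ (Fin N) → ℝ}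
    (hD : Continuous D) (hV : Continuous V) (hΦ : Continuous Φ)
    (hsub : ∀ η : EuclideanSpace ℝ (Fin N) → ℝ, ContDiff ℝ (⊤ : ℕ∞) η → HasCompactSupport η →
      (∀ y, 0 ≤ η y) → ∫ y, D y * η y ≤ (∫ y, V y * lapl η y) + ∫ y, Φ y * η y)
    {S : Set (EuclideanSpace ℝ (Fin N))} (hS : MeasurableSet S) (hVS : ∀ y ∉ S, V y ≤ 0)
    {x : EuclideanSpace ℝ (Fin N)} {ε c₀ : ℝ} (hε : 0 < ε)
    (hc₀ : ∀ y ∈ Metric.closedBall x ε, Φ y ≤ c₀) :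
    steklov κ ε D x ≤
      jump (h.kernel ε) (4 / ε ^ 2 * h.mass) (volume.restrict S) V x + c₀ := by
  refine (h.steklov_le hD hV hΦ hsub hε hc₀).trans (add_le_add_left ?_ c₀)
  have hi := h.integrable_kernel_mul hε x hV
  have h1 : ∫ y, h.kernel ε x y * V y ≤ ∫ y in S, h.kernel ε x y * V y := by
    rw [← integral_add_compl hS hi]
    have : ∫ y in Sᶜ, h.kernel ε x y * V y ≤ 0 :=
      setIntegral_nonpos hS.compl fun y hy =>
        mul_nonpos_of_nonneg_of_nonpos (h.kernel_nonneg hε x y) (hVS y hy)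
    linarith
  have h2 : ∫ y, h.kernel ε x y * V y =
      4 / ε ^ 2 * ∫ y, rescale (fun s => -deriv κ s) x ε y * V y := by
    rw [← integral_const_mul]
    simp only [kernel, mul_assoc]
  rw [jump]
  simp only [mass] at *
  linarith

end IsProfile
end SteklovKernel

section Comparison
variable {N : ℕ}

/-- `∂ₜ z ≤ ΔZ + K z⁺` between the times `t₁` and `t₂`, in the sense of distributions in space and
integrated in time. -/
def IsSubsolutionOn (K : ℝ) (z Z : EuclideanSpace ℝ (Fin N) → ℝ → ℝ) (t₁ t₂ : ℝ) : Prop :=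
  ∀ η : EuclideanSpace ℝ (Fin N) → ℝ, ContDiff ℝ (⊤ : ℕ∞) η → HasCompactSupport η →
    (∀ y, 0 ≤ η y) → ∫ y, (z y t₂ - z y t₁) * η y ≤
      (∫ y, (∫ t in t₁..t₂, Z y t) * lapl η y) + ∫ y, (K * ∫ t in t₁..t₂, max (z y t) 0) * η y

lemma continuous_integral_time {g : EuclideanSpace ℝ (Fin N) → ℝ → ℝ}
    (hg : Continuous (Function.uncurry g)) (a b : ℝ) : Continuous fun y => ∫ t in a..b, g y t :=
  intervalIntegral.continuous_parametric_intervalIntegral_of_continuous' hg a b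

lemma continuous_slice {g : EuclideanSpace ℝ (Fin N) → ℝ → ℝ}
    (hg : Continuous (Function.uncurry g)) (t : ℝ) : Continuous fun y => g y t :=
  hg.comp (continuous_id.prodMk continuous_const)

lemma continuous_path {g : EuclideanSpace ℝ (Fin N) → ℝ → ℝ}
    (hg : Continuous (Function.uncurry g)) (y : EuclideanSpace ℝ (Fin N)) : Continuous (g y) :=
  hg.comp (Continuous.prodMk_right y)

lemma IsProfile.steklov_increment_le {κ : ℝ → ℝ} (h : IsProfile N κ)
    {z Z : EuclideanSpace ℝ (Fin N) → ℝ → ℝ} {K t₁ t₂ ε d ω : ℝ}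
    (hz : Continuous (Function.uncurry z)) (hZ : Continuous (Function.uncurry Z)) (hK : 0 ≤ K)
    (ht : t₁ ≤ t₂) (hε : 0 < ε) (hsub : IsSubsolutionOn K z Z t₁ t₂)
    {S : Set (EuclideanSpace ℝ (Fin N))} (hS : IsCompact S)
    (hZS : ∀ y ∉ S, ∀ t, Z y t ≤ 0) {x : EuclideanSpace ℝ (Fin N)} (hx : x ∈ S)
    (hosc : ∀ y ∈ Metric.closedBall x ε, ∀ t ∈ Icc t₁ t₂, |z y t - z x t₁| ≤ d)
    (hoscZ : ∀ y ∈ S, ∀ t ∈ Icc t₁ t₂, |Z y t - Z y t₁| ≤ ω) :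
    steklov κ ε (fun y => z y t₂) x - steklov κ ε (fun y => z y t₁) x ≤
      (t₂ - t₁) * (jump (h.kernel ε) (4 / ε ^ 2 * h.mass) (volume.restrict S)
        (fun y => Z y t₁) x + K * max (z x t₁) 0 + (K * d + 2 * (4 / ε ^ 2 * h.mass) * ω)) := by
  set c := 4 / ε ^ 2 * h.mass with hc
  have hc0 : 0 ≤ c := mul_nonneg (by positivity) h.mass_nonneg
  have hmax : Continuous (Function.uncurry fun y t => max (z y t) 0) := hz.max continuous_const
  have hV := continuous_integral_time hZ t₁ t₂
  rw [← h.steklov_sub ε (continuous_slice hz t₂) (continuous_slice hz t₁)]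
  have hVS : ∀ y ∉ S, ∫ t in t₁..t₂, Z y t ≤ 0 := fun y hy => by
    have : ∫ t in t₁..t₂, Z y t ≤ ∫ _t in t₁..t₂, (0 : ℝ) :=
      intervalIntegral.integral_mono_on ht ((continuous_path hZ y).intervalIntegrable t₁ t₂)
      (intervalIntegrable_const (c := (0 : ℝ))) fun t _ => hZS y hy t
    simpa using this
  have hΦ : ∀ y ∈ Metric.closedBall x ε,
      K * ∫ t in t₁..t₂, max (z y t) 0 ≤ K * ((t₂ - t₁) * (max (z x t₁) 0 + d)) := fun y hy => by
    refine mul_le_mul_of_nonneg_left ?_ hK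
    have : ∫ t in t₁..t₂, max (z y t) 0 ≤ ∫ _t in t₁..t₂, (max (z x t₁) 0 + d) :=
      intervalIntegral.integral_mono_on ht
      ((continuous_path hmax y).intervalIntegrable t₁ t₂)
      (intervalIntegrable_const (c := max (z x t₁) 0 + d)) fun t ht' => by
        have h1 := hosc y hy t ht'
        have h2 := (abs_le.1 h1).2
        have h3 := (abs_nonneg _).trans h1
        refine max_le ?_ (add_nonneg (le_max_right _ _) h3)
        linarith [le_max_left (z x t₁) 0]
    simpa [mul_add] using this
  refine (h.steklov_le_jump ((continuous_slice hz t₂).sub (continuous_slice hz t₁)) hV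
    (continuous_const.mul (continuous_integral_time hmax t₁ t₂)) hsub hS.measurableSet hVS hε
    hΦ).trans ?_
  have hVo : ∀ y ∈ S, |(∫ t in t₁..t₂, Z y t) - (t₂ - t₁) * Z y t₁| ≤ (t₂ - t₁) * ω := by
    intro y hy
    have e1 : (∫ t in t₁..t₂, Z y t) - (t₂ - t₁) * Z y t₁ = ∫ t in t₁..t₂, (Z y t - Z y t₁) := by
      rw [intervalIntegral.integral_sub ((continuous_path hZ y).intervalIntegrable t₁ t₂)
        intervalIntegrable_const]
      simp
    rw [e1, ← Real.norm_eq_abs]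
    refine (intervalIntegral.norm_integral_le_of_norm_le_const (C := ω) fun t ht' => ?_).trans ?_
    · rw [uIoc_of_le ht] at ht'
      exact hoscZ y hy t ⟨ht'.1.le, ht'.2⟩
    · rw [abs_of_nonneg (sub_nonneg.2 ht), mul_comm]
  have hω : 0 ≤ ω := (abs_nonneg _).trans (hoscZ x hx t₁ ⟨le_rfl, ht⟩)
  have i0 := h.integrable_kernel_mul hε x (V := fun _ => 1) continuous_const
  have i1 := h.integrable_kernel_mul hε x hV
  have i2 := h.integrable_kernel_mul hε x (continuous_slice hZ t₁)
  have hint : ∫ y in S, h.kernel ε x y * ∫ t in t₁..t₂, Z y t ≤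
      (t₂ - t₁) * (∫ y in S, h.kernel ε x y * Z y t₁) + (t₂ - t₁) * ω * c := by
    have e2 : ∫ y in S, h.kernel ε x y ≤ c := (h.isJumpKernel hε S).mass_le x
    calc _ ≤ ∫ y in S, ((t₂ - t₁) * (h.kernel ε x y * Z y t₁) +
            (t₂ - t₁) * ω * (h.kernel ε x y * 1)) := by
          refine setIntegral_mono_on i1.integrableOn
            ((i2.const_mul _).add (i0.const_mul _)).integrableOn hS.measurableSet fun y hy => ?_
          have := mul_le_mul_of_nonneg_left
            (sub_le_iff_le_add.1 (abs_le.1 (hVo y hy)).2) (h.kernel_nonneg hε x y)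
          linarith
      _ = (t₂ - t₁) * (∫ y in S, h.kernel ε x y * Z y t₁) +
            (t₂ - t₁) * ω * ∫ y in S, h.kernel ε x y := by
          rw [integral_add (i2.const_mul _).integrableOn (i0.const_mul _).integrableOn,
            integral_const_mul, integral_const_mul]
          simp only [mul_one]
      _ ≤ _ := by
          have := mul_le_mul_of_nonneg_left e2 (mul_nonneg (sub_nonneg.2 ht) hω)
          linarith
  have hxV := mul_le_mul_of_nonneg_left (abs_le.1 (hVo x hx)).1 hc0
  simp only [jump]
  linarith

lemma exists_modulus {f : EuclideanSpace ℝ (Fin N) → ℝ → ℝ}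
    (hf : Continuous (Function.uncurry f)) (R s e : ℝ) {ε : ℝ} (hε : 0 < ε) :
    ∃ δ > 0, ∀ x ∈ Metric.closedBall (0 : EuclideanSpace ℝ (Fin N)) R,
      ∀ y ∈ Metric.closedBall (0 : EuclideanSpace ℝ (Fin N)) R, ∀ t ∈ Icc s e, ∀ t' ∈ Icc s e,
        dist x y ≤ δ → |t - t'| ≤ δ → |f x t - f y t'| ≤ ε := by
  have hK := (isCompact_closedBall (0 : EuclideanSpace ℝ (Fin N)) R).prod
    (isCompact_Icc (a := s) (b := e))
  obtain ⟨δ, hδ, h⟩ := Metric.uniformContinuousOn_iff.1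
    (hK.uniformContinuousOn_of_continuous hf.continuousOn) ε hε
  refine ⟨δ / 2, by positivity, fun x hx y hy t ht t' ht' hxy htt => ?_⟩
  refine (h (x, t) ⟨hx, ht⟩ (y, t') ⟨hy, ht'⟩ ?_).le
  rw [Prod.dist_eq, Real.dist_eq]
  exact max_lt (by simp only; linarith) (by simp only; linarith)

end Comparison

section Subtype
variable {X : Type*} [MeasurableSpace X] {P : X → X → ℝ} {c : ℝ} {μ : Measure X} {S : Set X}

lemma IsJumpKernel.subtype (hP : IsJumpKernel P c (μ.restrict S)) (hS : MeasurableSet S) :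
    IsJumpKernel (fun x y : S => P x y) c (μ.comap Subtype.val) where
  bddMeas := ⟨hP.bddMeas.1.comp (g := Function.uncurry P) (f := fun p : S × S => ((p.1 : X), (p.2 : X)))
    (by fun_prop), hP.bddMeas.2.imp fun _ hC p => hC (p.1, p.2)⟩
  nonneg x y := hP.nonneg x y
  symm x y := hP.symm x y
  mass_le x := by
    rw [integral_subtype_comap hS (fun y => P x y)]
    exact hP.mass_le x

lemma jump_subtype (hS : MeasurableSet S) (θ : X → ℝ) (x : S) :
    jump (fun x y : S => P x y) c (μ.comap Subtype.val) (fun y => θ y) x =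
      jump P c (μ.restrict S) θ x := by
  rw [jump, jump, integral_subtype_comap hS (fun y => P x y * θ y)]

lemma BddMeas.of_continuous {Y : Type*} [TopologicalSpace Y] [CompactSpace Y] [MeasurableSpace Y]
    [OpensMeasurableSpace Y] {f : Y → ℝ} (hf : Continuous f) : BddMeas f := by
  obtain ⟨C, hC⟩ := isCompact_univ.exists_bound_of_continuousOn hf.continuousOn
  exact ⟨hf.measurable, C, fun x => hC x (mem_univ x)⟩

end Subtype

section Comparison
variable {N : ℕ}

/-- `z` is a subsolution of `∂ₜ z ≤ Δ(a z) + K z⁺` on `[s,e]` with `0 ≤ a = Z / z` locally bounded,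
which is nonpositive initially and far away. -/
structure IsSubsolution (K A R s e : ℝ) (z Z : EuclideanSpace ℝ (Fin N) → ℝ → ℝ) : Prop where
  continuous : Continuous (Function.uncurry z)
  continuous_flux : Continuous (Function.uncurry Z)
  nonpos_of_far : ∀ x ∉ Metric.closedBall 0 R, ∀ t, z x t ≤ 0
  flux_nonpos_of_far : ∀ x ∉ Metric.closedBall 0 R, ∀ t, Z x t ≤ 0
  flux_eq_zero : ∀ x t, z x t = 0 → Z x t = 0
  div_nonneg : ∀ x t, 0 ≤ Z x t / z x t
  div_le : ∀ x ∈ Metric.closedBall 0 (R + 1), ∀ t, Z x t / z x t ≤ A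
  sub : ∀ t₁ t₂, s ≤ t₁ → t₁ ≤ t₂ → t₂ ≤ e → IsSubsolutionOn K z Z t₁ t₂
  init : ∀ x, z x s ≤ 0

namespace IsSubsolution
variable {K A R s e : ℝ} {z Z : EuclideanSpace ℝ (Fin N) → ℝ → ℝ}

lemma exists_integral_mul_le (H : IsSubsolution K A R s e z Z) (hK : 0 ≤ K) (hR : 0 ≤ R)
    {χ : EuclideanSpace ℝ (Fin N) → ℝ} {L : NNReal} (hχ : LipschitzWith L χ)
    (hχ0 : ∀ x, 0 ≤ χ x) (hχ1 : ∀ x, χ x ≤ 1) (hχR : ∀ x ∉ Metric.closedBall 0 R, χ x = 0)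
    {t : ℝ} (hst : s < t) (hte : t ≤ e) :
    ∃ C, ∀ l : ℝ, 0 < l → l ≤ 1 → ∃ n : ℕ, 0 < n ∧
      ∫ x in Metric.closedBall 0 (R + 1), z x t * χ x ≤
        K * ∑ k ∈ Finset.range n, (t - s) / n *
          (∫ x in Metric.closedBall 0 (R + 1), max (z x (s + k * ((t - s) / n))) 0) + l * C := by
  obtain ⟨κ, h⟩ := exists_isProfile N
  set B : Set (EuclideanSpace ℝ (Fin N)) := Metric.closedBall 0 (R + 1) with hB
  have hBc : IsCompact B := isCompact_closedBall _ _
  have hBm : MeasurableSet B := hBc.measurableSet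
  set μ : Measure B := Measure.comap Subtype.val volume with hμ
  have : IsFiniteMeasure μ := by
    refine ⟨?_⟩
    rw [hμ, (MeasurableEmbedding.subtype_coe hBm).comap_apply, image_univ, Subtype.range_coe]
    exact hBc.measure_lt_top
  have : CompactSpace B := isCompact_iff_compactSpace.1 hBc
  have h0B : (0 : EuclideanSpace ℝ (Fin N)) ∈ B := by
    rw [hB, Metric.mem_closedBall, dist_self]
    linarith
  have : Nonempty B := ⟨⟨0, h0B⟩⟩
  have hA0 : 0 ≤ A := (H.div_nonneg 0 s).trans (H.div_le 0 h0B s)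
  -- bound on `z`
  obtain ⟨M, hM⟩ := (hBc.prod (isCompact_Icc (a := s) (b := t))).exists_bound_of_continuousOn
    H.continuous.continuousOn
  set E : ℝ := 2 * h.mass * (L : ℝ) ^ 2 * μ.real univ with hE
  refine ⟨(A + 1 + M) * (E + (t - s) * μ.real univ) / 2 + (t - s) * μ.real univ
    + 2 * μ.real univ, fun l hl hl1 => ?_⟩
  have hl2 : 0 < l ^ 2 := by positivity
  have hl21 : l ^ 2 ≤ 1 := pow_le_one₀ hl.le hl1
  obtain ⟨δ, hδ, hzδ⟩ := exists_modulus H.continuous (R + 2) s e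
    (ε := l ^ 2 / (2 * (K + 1))) (by positivity)
  set ε := min δ 1 with hε'
  have hε : 0 < ε := lt_min hδ one_pos
  set c := 4 / ε ^ 2 * h.mass with hc
  have hc0 : 0 ≤ c := mul_nonneg (by positivity) h.mass_nonneg
  obtain ⟨δ', hδ', hZδ⟩ := exists_modulus H.continuous_flux (R + 2) s e
    (ε := l ^ 2 / (4 * (c + 1))) (by positivity)
  obtain ⟨n, hn⟩ := exists_nat_gt (max ((t - s) / min δ δ') ((t - s) * (2 * c * (A + 1))))
  have hts : 0 < t - s := sub_pos.2 hst
  have hδδ : 0 < min δ δ' := lt_min hδ hδ'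
  have hn0 : (0 : ℝ) < n := lt_of_le_of_lt (le_max_of_le_left (by positivity)) hn
  set τ := (t - s) / n with hτ'
  have hτ : 0 < τ := by positivity
  have hnτ : n * τ = t - s := by rw [hτ']; field_simp
  have hτδ : τ ≤ min δ δ' := by
    rw [hτ', div_le_iff₀ hn0, ← div_le_iff₀' hδδ]
    exact (le_max_left _ _).trans hn.le
  have hcfl : 2 * τ * c * (A + 1) ≤ 1 := by
    have : (t - s) * (2 * c * (A + 1)) ≤ n := (le_max_right _ _).trans hn.le
    calc 2 * τ * c * (A + 1) = (t - s) * (2 * c * (A + 1)) / n := by rw [hτ']; ring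
      _ ≤ 1 := (div_le_one hn0).2 this
  have htime : ∀ k : ℕ, k ≤ n → s + k * τ ∈ Icc s t := fun k hk => by
    have h1 : (k : ℝ) * τ ≤ n * τ :=
      mul_le_mul_of_nonneg_right (by exact_mod_cast hk) hτ.le
    exact ⟨by linarith [mul_nonneg (Nat.cast_nonneg (α := ℝ) k) hτ.le], by linarith⟩
  have hsubB : B ⊆ Metric.closedBall 0 (R + 2) := Metric.closedBall_subset_closedBall (by linarith)
  have hnear : ∀ x ∈ B, ∀ y ∈ Metric.closedBall x ε, y ∈ Metric.closedBall 0 (R + 2) := by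
    intro x hx y hy
    rw [hB, Metric.mem_closedBall] at hx
    rw [Metric.mem_closedBall] at hy ⊢
    linarith [dist_triangle y x 0, min_le_right δ 1]
  have hKd : K * (l ^ 2 / (2 * (K + 1))) ≤ l ^ 2 / 2 := by
    rw [mul_div_assoc', div_le_div_iff₀ (by positivity) (by positivity)]
    nlinarith
  have hcω : 2 * c * (l ^ 2 / (4 * (c + 1))) ≤ l ^ 2 / 2 := by
    rw [mul_div_assoc', div_le_div_iff₀ (by positivity) (by positivity)]
    nlinarith
  have hdl : l ^ 2 / (2 * (K + 1)) ≤ l ^ 2 :=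
    div_le_self hl2.le (by linarith)
  have hJ := (h.isJumpKernel hε B).subtype hBm
  rw [← hμ] at hJ
  have hcoe : ∀ t, Continuous fun x : B => z x t := fun t =>
    (continuous_slice H.continuous t).comp continuous_subtype_val
  have hcoe' : ∀ t, Continuous fun x : B => steklov κ ε (fun y => z y t) x := fun t =>
    (h.continuous_steklov ε (continuous_slice H.continuous t)).comp continuous_subtype_val
  have hmul : ∀ x t, Z x t / z x t * z x t = Z x t := fun x t => by
    by_cases hz : z x t = 0
    · rw [hz, mul_zero, H.flux_eq_zero x t hz]
    · exact div_mul_cancel₀ _ hz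
  have main := hJ.integral_mul_le_of_discrete_subsolution (τ := τ) (A := A) (K := K) (M := M)
    (E := E) (l := l) (n := n) (a := fun k x => Z x (s + k * τ) / z x (s + k * τ))
    (z := fun k x => z x (s + k * τ)) (z' := fun k x => steklov κ ε (fun y => z y (s + k * τ)) x)
    (χ := fun x => χ x)
    (fun k => ⟨((continuous_slice H.continuous_flux _).measurable.div
      (continuous_slice H.continuous _).measurable).comp measurable_subtype_coe, A, fun x => by
        rw [abs_of_nonneg (H.div_nonneg _ _)]
        exact H.div_le x x.2 _⟩)
    (fun k x => H.div_nonneg _ _) (fun k x => H.div_le x x.2 _) hc0 hτ.le hK hl hl1 hcfl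
    (BddMeas.of_continuous (hχ.continuous.comp continuous_subtype_val)) (fun x => hχ0 x)
    (fun x => hχ1 x) ?_ (fun k => BddMeas.of_continuous (hcoe _))
    (fun k => BddMeas.of_continuous (hcoe' _)) (fun k hk x => hM (x, s + k * τ) ⟨x.2, htime k hk⟩)
    (fun k hk x => ?_) (fun x => by simpa using H.init x) (fun k hk x => ?_)
  · refine ⟨n, by exact_mod_cast hn0, ?_⟩
    rw [hnτ, show s + (t - s) = t by ring, hμ, integral_subtype_comap hBm (fun x => z x t * χ x)]
      at main
    simp_rw [fun k : ℕ => integral_subtype_comap (μ := volume) hBm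
      (fun x => max (z x (s + k * τ)) 0)] at main
    exact main
  · refine (hJ.energy_le_of_sq_sub_le (d := (L * ε) ^ 2)
      (BddMeas.of_continuous (hχ.continuous.comp continuous_subtype_val)) (fun x hx => ?_)
      (by positivity) (fun x y hxy => ?_)).trans (le_of_eq ?_)
    · rw [hμ, integral_subtype_comap hBm (fun y => h.kernel ε x y)]
      refine h.setIntegral_kernel_eq hε fun y hy => ?_
      have hxR : (x : EuclideanSpace ℝ (Fin N)) ∈ Metric.closedBall 0 R := by
        by_contra hxR
        exact hx (hχR _ hxR)
      rw [Metric.mem_closedBall] at hxR hy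
      rw [hB, Metric.mem_closedBall]
      linarith [dist_triangle y (x : EuclideanSpace ℝ (Fin N)) 0, min_le_right δ 1]
    · change (χ x - χ y) ^ 2 ≤ _
      have hy : (y : EuclideanSpace ℝ (Fin N)) ∈
          Metric.closedBall (x : EuclideanSpace ℝ (Fin N)) ε := by
        by_contra hy
        exact hxy (h.kernel_eq_zero hε hy)
      rw [← sq_abs (χ x - χ y), ← Real.dist_eq]
      refine pow_le_pow_left₀ dist_nonneg ((hχ.dist_le_mul _ _).trans ?_) 2
      rw [dist_comm]
      exact mul_le_mul_of_nonneg_left hy L.2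
    · rw [hE]
      field_simp
      ring
  · refine (h.abs_steklov_sub_le hε (continuous_slice H.continuous _) fun y hy => ?_).trans hdl
    have hk' := htime k hk
    rw [abs_sub_comm]
    refine hzδ x (hsubB x.2) y (hnear x x.2 y hy) _ ⟨hk'.1, hk'.2.trans hte⟩ _
      ⟨hk'.1, hk'.2.trans hte⟩ ?_ (by simpa using hδ.le)
    rw [dist_comm]
    exact (Metric.mem_closedBall.1 hy).trans (min_le_left _ _)
  · have h1 := htime k hk.le
    have h2 := htime (k + 1) hk
    have e1 : s + ((k + 1 : ℕ) : ℝ) * τ = s + k * τ + τ := by push_cast; ring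
    rw [e1] at h2
    simp only [e1]
    have hstep := h.steklov_increment_le (t₁ := s + k * τ) (t₂ := s + k * τ + τ) H.continuous
      H.continuous_flux hK (by linarith) hε (H.sub _ _ h1.1 (by linarith) (h2.2.trans hte)) hBc
      (fun y hy => H.flux_nonpos_of_far y fun hy' =>
        hy (Metric.closedBall_subset_closedBall (by linarith) hy')) x.2
      (d := l ^ 2 / (2 * (K + 1))) (ω := l ^ 2 / (4 * (c + 1)))
      (fun y hy t' ht' => by
        rw [abs_sub_comm]
        refine hzδ x (hsubB x.2) y (hnear x x.2 y hy) _ ⟨h1.1, h1.2.trans hte⟩ _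
          ⟨h1.1.trans ht'.1, ht'.2.trans (h2.2.trans hte)⟩ ?_ ?_
        · rw [dist_comm]
          exact (Metric.mem_closedBall.1 hy).trans (min_le_left _ _)
        · rw [abs_sub_comm, abs_of_nonneg (by linarith [ht'.1])]
          linarith [ht'.2, min_le_left δ δ'])
      (fun y hy t' ht' => by
        refine hZδ y (hsubB hy) y (hsubB hy) _
          ⟨h1.1.trans ht'.1, ht'.2.trans (h2.2.trans hte)⟩ _ ⟨h1.1, h1.2.trans hte⟩
          (by simpa using hδ'.le) ?_
        rw [abs_of_nonneg (by linarith [ht'.1])]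
        linarith [ht'.2, min_le_right δ δ'])
    rw [add_sub_cancel_left] at hstep
    refine hstep.trans (mul_le_mul_of_nonneg_left ?_ hτ.le)
    simp only [hmul]
    rw [hμ, jump_subtype hBm (fun y => Z y (s + k * τ)) x]
    linarith

end IsSubsolution
end Comparison

section Comparison
variable {N : ℕ}

lemma mul_sum_exp_le {K Y τ : ℝ} (hY : 0 ≤ Y) (n : ℕ) :
    K * ∑ k ∈ Finset.range n, τ * (Y * Real.exp (2 * K * (k * τ))) ≤
      Y / 2 * Real.exp (2 * K * (n * τ)) := by
  have key : K * ∑ k ∈ Finset.range n, τ * (Y * Real.exp (2 * K * (k * τ))) ≤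
      Y / 2 * (Real.exp (2 * K * (n * τ)) - 1) := by
    induction n with
    | zero => simp
    | succ n ih =>
      rw [Finset.sum_range_succ, mul_add]
      have h1 : 2 * K * τ ≤ Real.exp (2 * K * τ) - 1 := by
        linarith [Real.add_one_le_exp (2 * K * τ)]
      have h2 : Real.exp (2 * K * ((n + 1 : ℕ) * τ)) =
          Real.exp (2 * K * (n * τ)) * Real.exp (2 * K * τ) := by
        rw [← Real.exp_add]
        push_cast
        ring_nf
      rw [h2]
      have h3 := mul_le_mul_of_nonneg_left h1
        (mul_nonneg (half_pos one_pos).le (mul_nonneg hY (Real.exp_pos (2 * K * (n * τ))).le))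
      linarith
  linarith

lemma lipschitzWith_min_one_mul_infDist (F : Set (EuclideanSpace ℝ (Fin N))) (n : ℕ) :
    LipschitzWith n fun x => min 1 (n * Metric.infDist x F) := by
  refine LipschitzWith.const_min (LipschitzWith.of_dist_le_mul fun x y => ?_) 1
  rw [Real.dist_eq, ← mul_sub, abs_mul, abs_of_nonneg (Nat.cast_nonneg n), ← Real.dist_eq]
  have := (Metric.lipschitz_infDist_pt F).dist_le_mul x y
  rw [NNReal.coe_one, one_mul] at this
  exact mul_le_mul_of_nonneg_left this (Nat.cast_nonneg n)

namespace IsSubsolution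
variable {K A R s e : ℝ} {z Z : EuclideanSpace ℝ (Fin N) → ℝ → ℝ}

lemma integral_mul_le_of_exp (H : IsSubsolution K A R s e z Z) (hK : 0 ≤ K) (hR : 0 ≤ R)
    {χ : EuclideanSpace ℝ (Fin N) → ℝ} {L : NNReal} (hχ : LipschitzWith L χ)
    (hχ0 : ∀ x, 0 ≤ χ x) (hχ1 : ∀ x, χ x ≤ 1) (hχR : ∀ x ∉ Metric.closedBall 0 R, χ x = 0)
    {t : ℝ} (hst : s < t) (hte : t ≤ e) {Y : ℝ} (hY : 0 ≤ Y)
    (hz : ∀ τ ∈ Icc s e, ∫ x in Metric.closedBall 0 (R + 1), max (z x τ) 0 ≤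
      Y * Real.exp (2 * K * (τ - s))) :
    ∫ x in Metric.closedBall 0 (R + 1), z x t * χ x ≤ Y / 2 * Real.exp (2 * K * (t - s)) := by
  obtain ⟨C, hC⟩ := H.exists_integral_mul_le hK hR hχ hχ0 hχ1 hχR hst hte
  refine le_of_forall_pos_le_add fun ε hε => ?_
  set l := min 1 (ε / (|C| + 1)) with hl
  have hl0 : 0 < l := lt_min one_pos (by positivity)
  obtain ⟨n, hn, hle⟩ := hC l hl0 (min_le_left _ _)
  have hn' : (0 : ℝ) < n := by exact_mod_cast hn
  have hts : 0 < t - s := sub_pos.2 hst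
  have hsum : K * ∑ k ∈ Finset.range n, (t - s) / n *
      (∫ x in Metric.closedBall 0 (R + 1), max (z x (s + k * ((t - s) / n))) 0) ≤
      K * ∑ k ∈ Finset.range n, (t - s) / n * (Y * Real.exp (2 * K * (k * ((t - s) / n)))) := by
    refine mul_le_mul_of_nonneg_left (Finset.sum_le_sum fun k hk => ?_) hK
    refine mul_le_mul_of_nonneg_left ?_ (by positivity)
    have hk' : (k : ℝ) * ((t - s) / n) ≤ t - s := by
      calc (k : ℝ) * ((t - s) / n) ≤ n * ((t - s) / n) :=
            mul_le_mul_of_nonneg_right (by exact_mod_cast (Finset.mem_range.1 hk).le)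
              (by positivity)
        _ = t - s := by field_simp
    have hk0 : 0 ≤ (k : ℝ) * ((t - s) / n) := by positivity
    have := hz (s + k * ((t - s) / n)) ⟨by linarith, by linarith⟩
    rwa [add_sub_cancel_left] at this
  have hexp := mul_sum_exp_le (K := K) (τ := (t - s) / n) hY n
  rw [mul_div_cancel₀ _ hn'.ne'] at hexp
  have hlC : l * C ≤ ε := by
    calc l * C ≤ l * (|C| + 1) :=
          mul_le_mul_of_nonneg_left (by linarith [le_abs_self C]) hl0.le
      _ ≤ ε / (|C| + 1) * (|C| + 1) :=
          mul_le_mul_of_nonneg_right (min_le_right _ _) (by positivity)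
      _ = ε := by field_simp
  linarith

lemma integral_max_le_of_exp [Nonempty (Fin N)] (H : IsSubsolution K A R s e z Z) (hK : 0 ≤ K)
    (hR : 0 ≤ R) {Y : ℝ} (hY : 0 ≤ Y)
    (hz : ∀ τ ∈ Icc s e, ∫ x in Metric.closedBall 0 (R + 1), max (z x τ) 0 ≤
      Y * Real.exp (2 * K * (τ - s))) {t : ℝ} (ht : t ∈ Icc s e) :
    ∫ x in Metric.closedBall 0 (R + 1), max (z x t) 0 ≤ Y / 2 * Real.exp (2 * K * (t - s)) := by
  rcases ht.1.eq_or_lt with rfl | hst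
  · have : ∀ x, max (z x s) 0 = 0 := fun x => max_eq_right (H.init x)
    simp only [this, integral_zero]
    positivity
  have hzc := continuous_slice H.continuous t
  set F := {x | z x t ≤ 0} with hF
  have hFc : IsClosed F := isClosed_le hzc continuous_const
  have hFn : F.Nonempty := by
    obtain ⟨x, hx⟩ := NormedSpace.exists_lt_norm ℝ (EuclideanSpace ℝ (Fin N)) R
    exact ⟨x, H.nonpos_of_far x (by simpa using hx) t⟩
  have hχR : ∀ n : ℕ, ∀ x ∉ Metric.closedBall 0 R, min 1 (n * Metric.infDist x F) = 0 := by
    intro n x hx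
    rw [Metric.infDist_zero_of_mem (show x ∈ F from H.nonpos_of_far x hx t), mul_zero,
      min_eq_right zero_le_one]
  have hle : ∀ n : ℕ, ∫ x in Metric.closedBall 0 (R + 1),
      z x t * min 1 (n * Metric.infDist x F) ≤ Y / 2 * Real.exp (2 * K * (t - s)) := fun n =>
    H.integral_mul_le_of_exp hK hR (lipschitzWith_min_one_mul_infDist F n)
      (fun x => le_min zero_le_one (mul_nonneg (Nat.cast_nonneg n) Metric.infDist_nonneg))
      (fun x => min_le_left _ _) (hχR n) hst ht.2 hY hz
  refine le_of_tendsto (tendsto_integral_of_dominated_convergence (fun x => |z x t|)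
    (fun n => ?_) ?_ (fun n => ?_) ?_) (Eventually.of_forall hle)
  · exact (hzc.mul (lipschitzWith_min_one_mul_infDist F n).continuous).aestronglyMeasurable
  · exact hzc.abs.continuousOn.integrableOn_compact (isCompact_closedBall _ _)
  · refine Eventually.of_forall fun x => ?_
    rw [Real.norm_eq_abs, abs_mul]
    refine mul_le_of_le_one_right (abs_nonneg _) ?_
    rw [abs_of_nonneg (le_min zero_le_one (mul_nonneg (Nat.cast_nonneg n) Metric.infDist_nonneg))]
    exact min_le_left _ _
  · refine Eventually.of_forall fun x => ?_
    refine tendsto_const_nhds.congr' ?_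
    by_cases hx : z x t ≤ 0
    · refine Eventually.of_forall fun n => ?_
      beta_reduce
      rw [Metric.infDist_zero_of_mem (show x ∈ F from hx), mul_zero, min_eq_right zero_le_one,
        mul_zero, max_eq_right hx]
    · have hpos : 0 < Metric.infDist x F := (hFc.notMem_iff_infDist_pos hFn).1 hx
      obtain ⟨n₀, hn₀⟩ := exists_nat_ge (1 / Metric.infDist x F)
      filter_upwards [eventually_ge_atTop n₀] with n hn
      have : 1 ≤ n * Metric.infDist x F := by
        rw [div_le_iff₀ hpos] at hn₀
        exact hn₀.trans (mul_le_mul_of_nonneg_right (by exact_mod_cast hn) hpos.le)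
      rw [min_eq_left this, mul_one, max_eq_left (not_le.1 hx).le]

/-- The comparison principle. -/
theorem nonpos [Nonempty (Fin N)] (H : IsSubsolution K A R s e z Z) (hK : 0 ≤ K) (hR : 0 ≤ R)
    {t : ℝ} (ht : t ∈ Icc s e) (x : EuclideanSpace ℝ (Fin N)) : z x t ≤ 0 := by
  have hBc : IsCompact (Metric.closedBall (0 : EuclideanSpace ℝ (Fin N)) (R + 1)) :=
    isCompact_closedBall _ _
  obtain ⟨M, hM⟩ := (hBc.prod (isCompact_Icc (a := s) (b := e))).exists_bound_of_continuousOn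
    H.continuous.continuousOn
  set V := volume.real (Metric.closedBall (0 : EuclideanSpace ℝ (Fin N)) (R + 1))
  have hiter : ∀ j : ℕ, ∀ τ ∈ Icc s e, ∫ x in Metric.closedBall 0 (R + 1), max (z x τ) 0 ≤
      |M| * V / 2 ^ j * Real.exp (2 * K * (τ - s)) := by
    intro j
    induction j with
    | zero =>
      intro τ hτ
      have h1 : ∫ x in Metric.closedBall 0 (R + 1), max (z x τ) 0 ≤ |M| * V := by
        refine (le_abs_self _).trans ?_
        rw [← Real.norm_eq_abs]
        refine norm_setIntegral_le_of_norm_le_const hBc.measure_lt_top fun x hx => ?_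
        rw [Real.norm_eq_abs, abs_of_nonneg (le_max_right _ _)]
        refine max_le ((le_abs_self _).trans ?_) (abs_nonneg _)
        exact (hM (x, τ) ⟨hx, hτ⟩).trans (le_abs_self M)
      have h2 : 1 ≤ Real.exp (2 * K * (τ - s)) :=
        Real.one_le_exp (mul_nonneg (by linarith) (sub_nonneg.2 hτ.1))
      have h3 : 0 ≤ |M| * V := by positivity
      rw [pow_zero, div_one]
      exact h1.trans (le_mul_of_one_le_right h3 h2)
    | succ j ih =>
      intro τ hτ
      have := H.integral_max_le_of_exp hK hR (by positivity) ih hτ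
      rwa [div_div, ← pow_succ] at this
  have hlim : Tendsto (fun j : ℕ => |M| * V / 2 ^ j * Real.exp (2 * K * (t - s))) atTop
      (nhds (0 * Real.exp (2 * K * (t - s)))) := by
    refine Tendsto.mul_const _ ?_
    have := (tendsto_pow_atTop_nhds_zero_of_lt_one (r := (1 / 2 : ℝ)) (by norm_num)
      (by norm_num)).const_mul (|M| * V)
    simpa [div_eq_mul_inv] using this
  rw [zero_mul] at hlim
  have hle : ∫ x in Metric.closedBall 0 (R + 1), max (z x t) 0 ≤ 0 :=
    ge_of_tendsto hlim (Eventually.of_forall fun j => hiter j t ht)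
  have hfar : ∀ x ∉ Metric.closedBall (0 : EuclideanSpace ℝ (Fin N)) (R + 1),
      max (z x t) 0 = 0 := fun x hx => max_eq_right (H.nonpos_of_far x
        (fun hx' => hx (Metric.closedBall_subset_closedBall (by linarith) hx')) t)
  rw [setIntegral_eq_integral_of_forall_compl_eq_zero hfar] at hle
  by_contra hx
  refine absurd hle (not_le.2 ?_)
  refine Continuous.integral_pos_of_hasCompactSupport_nonneg_nonzero (x := x)
    ((continuous_slice H.continuous t).max continuous_const)
    (HasCompactSupport.intro hBc hfar) (fun x => le_max_right _ _) ?_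
  rw [max_eq_left (not_le.1 hx).le]
  exact (not_le.1 hx).ne'

end IsSubsolution
end Comparison

section Barrier

lemma hasDerivAt_max_rpow {β : ℝ} (hβ : 1 < β) (s : ℝ) :
    HasDerivAt (fun s : ℝ => max s 0 ^ β) (β * max s 0 ^ (β - 1)) s := by
  rcases lt_trichotomy s 0 with hs | rfl | hs
  · rw [max_eq_right hs.le, Real.zero_rpow (by linarith), mul_zero]
    refine (hasDerivAt_const s (0 : ℝ)).congr_of_eventuallyEq ?_
    filter_upwards [Iio_mem_nhds hs] with y hy
    rw [max_eq_right (le_of_lt hy), Real.zero_rpow (by linarith)]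
  · rw [max_self, Real.zero_rpow (by linarith), mul_zero, ← hasDerivWithinAt_univ,
      ← Iic_union_Ici (a := (0 : ℝ))]
    refine HasDerivWithinAt.union ?_ ?_
    · refine (hasDerivWithinAt_const (0 : ℝ) _ (0 : ℝ)).congr (fun y hy => ?_) ?_
      · rw [max_eq_right hy, Real.zero_rpow (by linarith)]
      · rw [max_self, Real.zero_rpow (by linarith)]
    · have h := (Real.hasDerivAt_rpow_const (x := 0) (p := β) (Or.inr hβ.le)).hasDerivWithinAt
        (s := Ici 0)
      rw [Real.zero_rpow (by linarith), mul_zero] at h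
      refine h.congr (fun y hy => ?_) ?_
      · rw [max_eq_left hy]
      · rw [max_self]
  · rw [max_eq_left hs.le]
    refine (Real.hasDerivAt_rpow_const (Or.inl hs.ne')).congr_of_eventuallyEq ?_
    filter_upwards [Ioi_mem_nhds hs] with y hy
    rw [max_eq_left (le_of_lt hy)]

lemma continuous_max_rpow {β : ℝ} (hβ : 0 ≤ β) : Continuous fun s : ℝ => max s 0 ^ β :=
  (Real.continuous_rpow_const hβ).comp (continuous_id.max continuous_const)

lemma contDiff_two_max_rpow {β : ℝ} (hβ : 2 < β) : ContDiff ℝ 2 fun s : ℝ => max s 0 ^ β := by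
  have h1 : ∀ γ : ℝ, 1 < γ → ContDiff ℝ 1 fun s : ℝ => max s 0 ^ γ := fun γ hγ => by
    rw [contDiff_one_iff_deriv]
    refine ⟨fun s => (hasDerivAt_max_rpow hγ s).differentiableAt, ?_⟩
    rw [funext fun s => (hasDerivAt_max_rpow hγ s).deriv]
    exact (continuous_max_rpow (by linarith)).const_mul γ
  rw [show (2 : WithTop ℕ∞) = 1 + 1 by norm_num, contDiff_succ_iff_deriv]
  refine ⟨fun s => (hasDerivAt_max_rpow (by linarith) s).differentiableAt, by simp, ?_⟩
  rw [funext fun s => (hasDerivAt_max_rpow (β := β) (by linarith) s).deriv]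
  exact contDiff_const.mul (h1 _ (by linarith))

variable {N : ℕ}

lemma continuous_lapl {f : EuclideanSpace ℝ (Fin N) → ℝ} (hf : ContDiff ℝ 2 f) :
    Continuous (lapl f) := by
  refine continuous_finsetSum _ fun i _ => ?_
  have h1 : ContDiff ℝ 1 fun y => fderiv ℝ f y (EuclideanSpace.single i (1 : ℝ)) :=
    (hf.fderiv_right (m := 1) (by norm_num)).clm_apply contDiff_const
  exact (h1.continuous_fderiv (by norm_num)).clm_apply continuous_const

lemma hasCompactSupport_lapl {f : EuclideanSpace ℝ (Fin N) → ℝ} (hf : HasCompactSupport f) :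
    HasCompactSupport (lapl f) := by
  refine hf.mono' fun x hx => ?_
  by_contra hx'
  refine hx (Finset.sum_eq_zero fun i _ => ?_)
  have hcs := support_fderiv_subset ℝ (f := fun y => fderiv ℝ f y (EuclideanSpace.single i (1 : ℝ)))
  have h0 : fderiv ℝ (fun y => fderiv ℝ f y (EuclideanSpace.single i (1 : ℝ))) x = 0 := by
    by_contra h0
    have h1 := hcs h0
    refine hx' (closure_minimal (fun y hy => ?_) (isClosed_tsupport f) h1)
    refine support_fderiv_subset ℝ fun h2 => hy ?_
    change fderiv ℝ f y _ = 0
    rw [h2]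
    simp
  rw [h0]
  simp

lemma integral_lapl_mul {W η : EuclideanSpace ℝ (Fin N) → ℝ} (hW : ContDiff ℝ 2 W)
    (hη : ContDiff ℝ 2 η) (hc : HasCompactSupport η) :
    ∫ y, lapl W y * η y = ∫ y, W y * lapl η y := by
  have hd : ∀ {f : EuclideanSpace ℝ (Fin N) → ℝ}, ContDiff ℝ 2 f → ∀ i,
      ContDiff ℝ 1 fun y => fderiv ℝ f y (EuclideanSpace.single i (1 : ℝ)) := fun hf i =>
    (hf.fderiv_right (m := 1) (by norm_num)).clm_apply contDiff_const
  have hdd : ∀ {f : EuclideanSpace ℝ (Fin N) → ℝ}, ContDiff ℝ 2 f → ∀ i, Continuous fun x =>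
      fderiv ℝ (fun y => fderiv ℝ f y (EuclideanSpace.single i (1 : ℝ))) x
        (EuclideanSpace.single i (1 : ℝ)) := fun hf i =>
    ((hd hf i).continuous_fderiv (by norm_num)).clm_apply continuous_const
  have hcd : ∀ i, HasCompactSupport fun y => fderiv ℝ η y (EuclideanSpace.single i (1 : ℝ)) :=
    fun i => hc.fderiv_apply ℝ _
  have hcdd : ∀ i, HasCompactSupport fun x =>
      fderiv ℝ (fun y => fderiv ℝ η y (EuclideanSpace.single i (1 : ℝ))) x
        (EuclideanSpace.single i (1 : ℝ)) := fun i => (hcd i).fderiv_apply ℝ _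
  simp only [lapl, Finset.sum_mul, Finset.mul_sum]
  rw [integral_finsetSum _ fun i _ =>
      ((hdd hW i).fun_mul hη.continuous).integrable_of_hasCompactSupport hc.mul_left,
    integral_finsetSum _ fun i _ =>
      (hW.continuous.fun_mul (hdd hη i)).integrable_of_hasCompactSupport (hcdd i).mul_left]
  refine Finset.sum_congr rfl fun i _ => ?_
  have e1 := integral_mul_fderiv_eq_neg_fderiv_mul_of_integrable (μ := volume)
    (f := fun y => fderiv ℝ W y (EuclideanSpace.single i (1 : ℝ))) (g := η)
    (v := EuclideanSpace.single i (1 : ℝ))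
    (((hdd hW i).mul hη.continuous).integrable_of_hasCompactSupport hc.mul_left)
    (((hd hW i).continuous.mul (hd hη i).continuous).integrable_of_hasCompactSupport
      (hcd i).mul_left)
    (((hd hW i).continuous.mul hη.continuous).integrable_of_hasCompactSupport hc.mul_left)
    (fun x _ => (hd hW i).differentiable (by norm_num) x)
    (fun x _ => hη.differentiable (by norm_num) x)
  have e2 := integral_mul_fderiv_eq_neg_fderiv_mul_of_integrable (μ := volume)
    (f := W) (g := fun y => fderiv ℝ η y (EuclideanSpace.single i (1 : ℝ)))
    (v := EuclideanSpace.single i (1 : ℝ))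
    (((hd hW i).continuous.mul (hd hη i).continuous).integrable_of_hasCompactSupport
      (hcd i).mul_left)
    ((hW.continuous.mul (hdd hη i)).integrable_of_hasCompactSupport (hcdd i).mul_left)
    ((hW.continuous.mul (hd hη i).continuous).integrable_of_hasCompactSupport (hcd i).mul_left)
    (fun x _ => hW.differentiable (by norm_num) x)
    (fun x _ => (hd hη i).differentiable (by norm_num) x)
  rw [e2, e1, neg_neg]

end Barrier

section Barrier
variable {N : ℕ}

lemma integral_time_mul {g : EuclideanSpace ℝ (Fin N) → ℝ → ℝ}
    (hg : Continuous (Function.uncurry g)) {η : EuclideanSpace ℝ (Fin N) → ℝ}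
    (hη : Continuous η) (hc : HasCompactSupport η) (a b : ℝ) :
    ∫ t in a..b, ∫ x, g x t * η x = ∫ x, (∫ t in a..b, g x t) * η x := by
  rw [intervalIntegral_integral_swap]
  · simp only [intervalIntegral.integral_mul_const]
  · have hcont : Continuous (Function.uncurry fun (t : ℝ) x => g x t * η x) :=
      (hg.comp continuous_swap).mul (hη.comp continuous_snd)
    obtain ⟨C, hC⟩ := (hc.isCompact.prod
      (isCompact_uIcc (a := a) (b := b))).exists_bound_of_continuousOn hg.continuousOn
    have : IsFiniteMeasure ((volume : Measure ℝ).restrict (uIoc a b)) :=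
      ⟨by rw [Measure.restrict_apply_univ]; exact measure_Ioc_lt_top⟩
    refine Integrable.mono' (g := fun p : ℝ × EuclideanSpace ℝ (Fin N) => C * ‖η p.2‖)
      (Integrable.mul_prod (f := fun _ : ℝ => C) (integrable_const C)
        (hη.integrable_of_hasCompactSupport hc).norm) hcont.aestronglyMeasurable ?_
    rw [← Measure.restrict_univ (μ := (volume : Measure (EuclideanSpace ℝ (Fin N)))),
      Measure.prod_restrict]
    filter_upwards [ae_restrict_mem (measurableSet_uIoc.prod MeasurableSet.univ)] with p hp
    rw [Function.uncurry, norm_mul]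
    by_cases h0 : η p.2 = 0
    · simp [h0]
    · exact mul_le_mul_of_nonneg_right (hC (p.2, p.1) ⟨subset_tsupport _ h0, uIoc_subset_uIcc hp.1⟩)
        (norm_nonneg _)

lemma integral_sub_mul_le_of_le_lapl {w w' W : EuclideanSpace ℝ (Fin N) → ℝ → ℝ} {K t₁ t₂ : ℝ}
    (hw : Continuous (Function.uncurry w)) (hw' : Continuous (Function.uncurry w'))
    (hder : ∀ x t, HasDerivAt (w x) (w' x t) t)
    (hW : Continuous (Function.uncurry W)) (hW2 : ∀ t, ContDiff ℝ 2 fun x => W x t)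
    (hlapl : Continuous (Function.uncurry fun x t => lapl (fun y => W y t) x))
    (hle : ∀ x t, w' x t ≤ lapl (fun y => W y t) x + K * w x t) (ht : t₁ ≤ t₂)
    {η : EuclideanSpace ℝ (Fin N) → ℝ} (hη : ContDiff ℝ (⊤ : ℕ∞) η) (hc : HasCompactSupport η)
    (hη0 : ∀ y, 0 ≤ η y) :
    ∫ x, (w x t₂ - w x t₁) * η x ≤
      (∫ x, (∫ t in t₁..t₂, W x t) * lapl η x) + ∫ x, (K * ∫ t in t₁..t₂, w x t) * η x := by
  have hη2 : ContDiff ℝ 2 η := hη.of_le (WithTop.coe_le_coe.2 (le_top (a := (2 : ℕ∞))))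
  have hηc := hη.continuous
  have h1 : ∫ x, (∫ t in t₁..t₂, W x t) * lapl η x =
      ∫ x, (∫ t in t₁..t₂, lapl (fun y => W y t) x) * η x := by
    rw [← integral_time_mul hW (continuous_lapl hη2) (hasCompactSupport_lapl hc),
      ← integral_time_mul hlapl hηc hc]
    exact intervalIntegral.integral_congr fun t _ => (integral_lapl_mul (hW2 t) hη2 hc).symm
  have hi : ∀ {f : EuclideanSpace ℝ (Fin N) → ℝ}, Continuous f →
      Integrable fun x => f x * η x := fun hf =>
    (hf.mul hηc).integrable_of_hasCompactSupport hc.mul_left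
  have c1 := continuous_integral_time hlapl t₁ t₂
  have c2 := (continuous_integral_time hw t₁ t₂).const_mul K
  rw [h1, ← integral_add (hi c1) (hi c2)]
  refine integral_mono (hi ((continuous_slice hw _).sub (continuous_slice hw _)))
    ((hi c1).add (hi c2)) fun x => ?_
  beta_reduce
  rw [← add_mul]
  refine mul_le_mul_of_nonneg_right ?_ (hη0 x)
  rw [← intervalIntegral.integral_eq_sub_of_hasDerivAt (fun t _ => hder x t)
      ((continuous_path hw' x).intervalIntegrable _ _), ← intervalIntegral.integral_const_mul,
    ← intervalIntegral.integral_add ((continuous_path hlapl x).intervalIntegrable _ _)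
      (((continuous_path hw x).const_mul K).intervalIntegrable _ _)]
  exact intervalIntegral.integral_mono_on ht ((continuous_path hw' x).intervalIntegrable _ _)
    (((continuous_path hlapl x).add ((continuous_path hw x).const_mul K)).intervalIntegrable _ _)
    fun t _ => hle x t

end Barrier

section Barrier
variable {N : ℕ}

/-- The power `(1 - |x - c - t v|² / ℓ²)₊^β` of a paraboloid travelling with velocity `v`. -/
def travelling (β ℓ : ℝ) (c v x : EuclideanSpace ℝ (Fin N)) (t : ℝ) : ℝ :=
  max (1 - ‖x - (c + t • v)‖ ^ 2 / ℓ ^ 2) 0 ^ β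

lemma travelling_nonneg (β ℓ : ℝ) (c v x : EuclideanSpace ℝ (Fin N)) (t : ℝ) :
    0 ≤ travelling β ℓ c v x t := Real.rpow_nonneg (le_max_right _ _) _

lemma travelling_le_one {β : ℝ} (hβ : 0 ≤ β) (ℓ : ℝ) (c v x : EuclideanSpace ℝ (Fin N)) (t : ℝ) :
    travelling β ℓ c v x t ≤ 1 :=
  Real.rpow_le_one (le_max_right _ _)
    (max_le (sub_le_self _ (by positivity)) zero_le_one) hβ

lemma travelling_eq_zero {β ℓ : ℝ} (hβ : 0 < β) (hℓ : 0 < ℓ) {c v x : EuclideanSpace ℝ (Fin N)}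
    {t : ℝ} (hx : ℓ ≤ ‖x - (c + t • v)‖) : travelling β ℓ c v x t = 0 := by
  have : 1 ≤ ‖x - (c + t • v)‖ ^ 2 / ℓ ^ 2 := by
    rw [le_div_iff₀ (by positivity), one_mul]
    exact pow_le_pow_left₀ hℓ.le hx 2
  rw [travelling, max_eq_right (by linarith), Real.zero_rpow hβ.ne']

lemma travelling_self (β ℓ : ℝ) (c v : EuclideanSpace ℝ (Fin N)) (t : ℝ) :
    travelling β ℓ c v (c + t • v) t = 1 := by
  simp [travelling]

lemma travelling_add {β γ : ℝ} (hβ : 0 < β) (hγ : 0 < γ) (ℓ : ℝ)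
    (c v x : EuclideanSpace ℝ (Fin N)) (t : ℝ) :
    travelling (β + γ) ℓ c v x t = travelling β ℓ c v x t * travelling γ ℓ c v x t :=
  Real.rpow_add_of_nonneg (le_max_right _ _) hβ.le hγ.le

lemma continuous_travelling {β : ℝ} (hβ : 0 ≤ β) (ℓ : ℝ) (c v : EuclideanSpace ℝ (Fin N)) :
    Continuous (Function.uncurry (travelling β ℓ c v)) := by
  refine (continuous_max_rpow hβ).comp
    (f := fun p : EuclideanSpace ℝ (Fin N) × ℝ => 1 - ‖p.1 - (c + p.2 • v)‖ ^ 2 / ℓ ^ 2) ?_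
  fun_prop

lemma hasDerivAt_travelling {β : ℝ} (hβ : 1 < β) (ℓ : ℝ) (c v x : EuclideanSpace ℝ (Fin N))
    (t : ℝ) :
    HasDerivAt (travelling β ℓ c v x)
      (β * travelling (β - 1) ℓ c v x t * (2 * ⟪x - (c + t • v), v⟫ / ℓ ^ 2)) t := by
  have h1 : HasDerivAt (fun t : ℝ => x - (c + t • v)) (-v) t := by
    have := (((hasDerivAt_id t).smul_const v).const_add c).const_sub x
    rwa [one_smul] at this
  have h2 := ((h1.norm_sq).div_const (ℓ ^ 2)).const_sub 1
  refine ((hasDerivAt_max_rpow hβ _).comp t h2).congr_deriv ?_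
  rw [inner_neg_right, travelling]
  ring

lemma hasDerivAt_max_one_sub_rpow {β : ℝ} (hβ : 1 < β) (ℓ s : ℝ) :
    HasDerivAt (fun s : ℝ => max (1 - s / ℓ ^ 2) 0 ^ β)
      (-(β / ℓ ^ 2) * max (1 - s / ℓ ^ 2) 0 ^ (β - 1)) s := by
  refine ((hasDerivAt_max_rpow hβ _).comp s
    (((hasDerivAt_id s).div_const (ℓ ^ 2)).const_sub 1)).congr_deriv ?_
  simp only [id]
  ring

lemma contDiff_travelling {β : ℝ} (hβ : 2 < β) (ℓ : ℝ) (c v : EuclideanSpace ℝ (Fin N)) (t : ℝ) :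
    ContDiff ℝ 2 fun x => travelling β ℓ c v x t := by
  refine (contDiff_two_max_rpow hβ).comp
    (f := fun x : EuclideanSpace ℝ (Fin N) => 1 - ‖x - (c + t • v)‖ ^ 2 / ℓ ^ 2) ?_
  exact contDiff_const.sub (((contDiff_id.sub contDiff_const).norm_sq ℝ).div_const _)

lemma lapl_travelling {β : ℝ} (hβ : 2 < β) (ℓ : ℝ) (c v x : EuclideanSpace ℝ (Fin N)) (t : ℝ) :
    lapl (fun y => travelling β ℓ c v y t) x =
      -(2 * N * β / ℓ ^ 2) * travelling (β - 1) ℓ c v x t +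
        4 * ‖x - (c + t • v)‖ ^ 2 * (β * (β - 1)) / ℓ ^ 4 * travelling (β - 2) ℓ c v x t := by
  have h := lapl_radial (fun s => hasDerivAt_max_one_sub_rpow (β := β) (by linarith) ℓ s)
    (fun s => (hasDerivAt_max_one_sub_rpow (β := β - 1) (by linarith) ℓ s).const_mul
      (-(β / ℓ ^ 2))) (c + t • v) x
  refine h.trans ?_
  rw [travelling, travelling, show β - 1 - 1 = β - 2 by ring]
  ring

lemma lapl_const_mul {f : EuclideanSpace ℝ (Fin N) → ℝ} (a : ℝ)
    (x : EuclideanSpace ℝ (Fin N)) : lapl (fun y => a * f y) x = a * lapl f x := by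
  have h : ∀ (g : EuclideanSpace ℝ (Fin N) → ℝ) y,
      fderiv ℝ (fun y => a * g y) y = a • fderiv ℝ g y := fun g y =>
    congrFun (fderiv_const_smul_field (f := g) a) y
  simp only [lapl, h, smul_apply, smul_eq_mul, Finset.mul_sum]

variable {m α δ ℓ : ℝ}

lemma continuous_lapl_travelling {β : ℝ} (hβ : 2 < β) (a ℓ : ℝ)
    (c v : EuclideanSpace ℝ (Fin N)) :
    Continuous (Function.uncurry fun x t => lapl (fun y => a * travelling β ℓ c v y t) x) := by
  have h : (fun x t => lapl (fun y => a * travelling β ℓ c v y t) x) = fun x t =>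
      a * (-(2 * N * β / ℓ ^ 2) * travelling (β - 1) ℓ c v x t +
        4 * ‖x - (c + t • v)‖ ^ 2 * (β * (β - 1)) / ℓ ^ 4 * travelling (β - 2) ℓ c v x t) := by
    funext x t
    rw [lapl_const_mul, lapl_travelling hβ]
  rw [h]
  have h1 := continuous_travelling (β := β - 1) (by linarith) ℓ c v
  have h2 := continuous_travelling (β := β - 2) (by linarith) ℓ c v
  refine continuous_const.mul ((continuous_const.mul h1).add (Continuous.mul ?_ h2))
  fun_prop

lemma deriv_travelling_le_lapl (hα : 1 < α) (hδ : 0 < δ) (hℓ : 0 < ℓ)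
    {c v : EuclideanSpace ℝ (Fin N)} (hv : ‖v‖ * ℓ ≤ (α + 1) * δ ^ (m - 1))
    (x : EuclideanSpace ℝ (Fin N)) (t : ℝ) :
    δ * (α * travelling (α - 1) ℓ c v x t * (2 * ⟪x - (c + t • v), v⟫ / ℓ ^ 2)) ≤
      lapl (fun y => δ ^ m * travelling (α + 1) ℓ c v y t) x +
        (α + 1) * (2 * N + 2 * α) * δ ^ (m - 1) / ℓ ^ 2 * (δ * travelling α ℓ c v x t) := by
  have hδm : δ ^ m = δ ^ (m - 1) * δ := by
    rw [← Real.rpow_add_one hδ.ne']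
    ring_nf
  have hP : travelling α ℓ c v x t = travelling (α - 1) ℓ c v x t * travelling 1 ℓ c v x t := by
    rw [← travelling_add (by linarith) one_pos, sub_add_cancel]
  rw [lapl_const_mul, lapl_travelling (by linarith), add_sub_cancel_right,
    show α + 1 - 2 = α - 1 by ring, hP, hδm]
  have hP0 := travelling_nonneg (α - 1) ℓ c v x t
  rcases lt_or_ge ‖x - (c + t • v)‖ ℓ with hx | hx
  · set r := ‖x - (c + t • v)‖ with hr
    have hr0 : 0 ≤ r := norm_nonneg _
    have hQ : travelling 1 ℓ c v x t = 1 - r ^ 2 / ℓ ^ 2 := by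
      rw [travelling, Real.rpow_one, max_eq_left]
      rw [sub_nonneg, div_le_one (by positivity)]
      exact pow_le_pow_left₀ hr0 hx.le 2
    have hin : ⟪x - (c + t • v), v⟫ ≤ r * ‖v‖ := real_inner_le_norm _ _
    rw [hQ]
    set B := (α + 1) * δ ^ (m - 1) with hB
    have hB0 : 0 ≤ B := (by positivity : 0 ≤ ‖v‖ * ℓ).trans hv
    have key : ⟪x - (c + t • v), v⟫ * ℓ ^ 2 ≤ B * (ℓ ^ 2 + r ^ 2) := by
      have h1 : ⟪x - (c + t • v), v⟫ * ℓ ^ 2 ≤ r * ℓ * (‖v‖ * ℓ) := by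
        calc ⟪x - (c + t • v), v⟫ * ℓ ^ 2 ≤ r * ‖v‖ * ℓ ^ 2 :=
              mul_le_mul_of_nonneg_right hin (by positivity)
          _ = r * ℓ * (‖v‖ * ℓ) := by ring
      have h2 : r * ℓ * (‖v‖ * ℓ) ≤ r * ℓ * B := mul_le_mul_of_nonneg_left hv (by positivity)
      have h3 : r * ℓ * B ≤ (ℓ ^ 2 + r ^ 2) * B :=
        mul_le_mul_of_nonneg_right (by nlinarith [sq_nonneg (r - ℓ)]) hB0
      linarith
    have hfac : 0 ≤ 2 * α * δ * travelling (α - 1) ℓ c v x t / ℓ ^ 4 := by positivity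
    have := mul_le_mul_of_nonneg_left key hfac
    refine (le_of_eq ?_).trans (this.trans (le_of_eq ?_))
    · field_simp
    · rw [hB]
      field_simp
      ring
  · rw [travelling_eq_zero (by linarith) hℓ hx]
    simp

end Barrier

section WeakForm
variable {N : ℕ}

lemma exists_time_cutoff {T t₁ t₂ : ℝ} (h0 : 0 < t₁) (h12 : t₁ ≤ t₂) (h2 : t₂ < T) :
    ∃ ψ : ℝ → ℝ, ContDiff ℝ (⊤ : ℕ∞) ψ ∧ HasCompactSupport ψ ∧ tsupport ψ ⊆ Ioo 0 T ∧
      ∀ t ∈ Icc t₁ t₂, ψ t = 1 ∧ deriv ψ t = 0 := by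
  set d := min t₁ (T - t₂) with hd
  have hd0 : 0 < d := lt_min h0 (by linarith)
  have hd1 : d ≤ t₁ := min_le_left _ _
  have hd2 : d ≤ T - t₂ := min_le_right _ _
  let ψ : ContDiffBump ((t₁ + t₂) / 2) :=
    ⟨(t₂ - t₁) / 2 + d / 3, (t₂ - t₁) / 2 + 2 * d / 3, by linarith, by linarith⟩
  refine ⟨ψ, ψ.contDiff, ψ.hasCompactSupport, ?_, fun t ht => ?_⟩
  · rw [ψ.tsupport_eq, Real.closedBall_eq_Icc]
    intro t ht
    change t ∈ Icc ((t₁ + t₂) / 2 - ((t₂ - t₁) / 2 + 2 * d / 3))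
      ((t₁ + t₂) / 2 + ((t₂ - t₁) / 2 + 2 * d / 3)) at ht
    exact ⟨by linarith [ht.1], by linarith [ht.2]⟩
  · have hb : t ∈ Metric.ball ((t₁ + t₂) / 2) ψ.rIn := by
      rw [Real.ball_eq_Ioo]
      change t ∈ Ioo ((t₁ + t₂) / 2 - ((t₂ - t₁) / 2 + d / 3))
        ((t₁ + t₂) / 2 + ((t₂ - t₁) / 2 + d / 3))
      exact ⟨by linarith [ht.1], by linarith [ht.2]⟩
    have he := ψ.eventuallyEq_one_of_mem_ball hb
    refine ⟨he.self_of_nhds, ?_⟩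
    rw [he.deriv_eq]
    simp

lemma continuous_integral_of_time_support {k : Set (EuclideanSpace ℝ (Fin N))} (hk : IsCompact k)
    {T : ℝ} {ψ : ℝ → ℝ} (hψ : tsupport ψ ⊆ Ioo 0 T) {f : ℝ → EuclideanSpace ℝ (Fin N) → ℝ}
    (hf : ContinuousOn (Function.uncurry f) (Ioo 0 T ×ˢ univ))
    (hfk : ∀ t, ∀ x ∉ k, f t x = 0) (hfψ : ∀ t ∉ tsupport ψ, ∀ x, f t x = 0) :
    Continuous fun t => ∫ x, f t x := by
  refine (continuousOn_integral_of_compact_support hk hf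
    fun t x _ hx => hfk t x hx).continuous_of_tsupport_subset isOpen_Ioo ?_
  refine (closure_minimal (fun t ht => ?_) (isClosed_tsupport ψ)).trans hψ
  by_contra h
  refine ht ?_
  simp only [hfψ t h, integral_zero]

namespace IsWeakSolution
variable {m p σ T : ℝ} {u : EuclideanSpace ℝ (Fin N) → ℝ → ℝ}
  {u₀ : EuclideanSpace ℝ (Fin N) → ℝ}

lemma integral_mul_sub_eq (hu : IsWeakSolution m p σ T u u₀) (hm : 0 ≤ m) (hp : 0 ≤ p)
    (huc : ContinuousOn (Function.uncurry u) (univ ×ˢ Ioo (0 : ℝ) T))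
    {η : EuclideanSpace ℝ (Fin N) → ℝ} (hη : ContDiff ℝ (⊤ : ℕ∞) η) (hc : HasCompactSupport η)
    {t₁ t₂ : ℝ} (h0 : 0 < t₁) (h12 : t₁ ≤ t₂) (h2 : t₂ < T) :
    (∫ x, u x t₂ * η x) - ∫ x, u x t₁ * η x =
      (∫ t in t₁..t₂, ∫ x, u x t ^ m * lapl η x) +
        ∫ t in t₁..t₂, ∫ x, (1 + ‖x‖) ^ σ * u x t ^ p * η x := by
  obtain ⟨ψ, hψ, hψc, hψs, hψ1⟩ := exists_time_cutoff h0 h12 h2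
  have hη2 : ContDiff ℝ 2 η := hη.of_le (WithTop.coe_le_coe.2 (le_top (a := (2 : ℕ∞))))
  have hlc := continuous_lapl hη2
  have hψ0 : ∀ t ∉ tsupport ψ, ψ t = 0 := fun t ht => image_eq_zero_of_notMem_tsupport ht
  have hψ'0 : ∀ t ∉ tsupport ψ, deriv ψ t = 0 := fun t ht => by
    by_contra h
    exact ht (support_deriv_subset h)
  have hη0 : ∀ x ∉ tsupport η, η x = 0 := fun x hx => image_eq_zero_of_notMem_tsupport hx
  have hl0 : ∀ x ∉ tsupport (lapl η), lapl η x = 0 := fun x hx =>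
    image_eq_zero_of_notMem_tsupport hx
  have htest : IsTestFn T fun x t => ψ t * η x := by
    refine ⟨(hψ.comp contDiff_snd).mul (hη.comp contDiff_fst), ?_, fun x t ht => ?_⟩
    · refine HasCompactSupport.intro (hc.isCompact.prod hψc.isCompact) fun q hq => ?_
      by_cases hq1 : q.1 ∈ tsupport η
      · have hq2 : q.2 ∉ tsupport ψ := fun hq2 => hq ⟨hq1, hq2⟩
        simp [Function.uncurry, hψ0 _ hq2]
      · simp [Function.uncurry, hη0 _ hq1]
    · beta_reduce
      rw [hψ0 t fun h => ht (hψs h), zero_mul]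
  set f : ℝ → EuclideanSpace ℝ (Fin N) → ℝ := fun τ x =>
    -(u x τ * deriv (fun t => ψ t * η x) τ) - u x τ ^ m * lapl (fun y => ψ τ * η y) x with hf
  set g : ℝ → EuclideanSpace ℝ (Fin N) → ℝ := fun τ x =>
    (1 + ‖x‖) ^ σ * u x τ ^ p * (ψ τ * η x) with hg
  have hfe : ∀ τ x, f τ x = -(u x τ * (deriv ψ τ * η x)) - u x τ ^ m * (ψ τ * lapl η x) := by
    intro τ x
    rw [hf]
    beta_reduce
    rw [lapl_const_mul, deriv_mul_const (hψ.differentiable (by simp) τ)]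
  have hus : ContinuousOn (fun q : ℝ × EuclideanSpace ℝ (Fin N) => u q.2 q.1)
      (Ioo 0 T ×ˢ univ) := huc.comp continuous_swap.continuousOn fun q hq => ⟨hq.2, hq.1⟩
  have hψd : Continuous (deriv ψ) := hψ.continuous_deriv (by simp)
  have hfc : Continuous fun t => ∫ x, f t x := by
    refine continuous_integral_of_time_support
      (hc.isCompact.union (hasCompactSupport_lapl hc).isCompact)
      hψs ?_ (fun t x hx => ?_) fun t ht x => ?_
    · rw [show Function.uncurry f = fun q => _ from funext fun q => hfe q.1 q.2]
      exact (hus.mul ((hψd.comp continuous_fst).mul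
        (hη.continuous.comp continuous_snd)).continuousOn).neg.sub
        ((hus.rpow_const fun _ _ => Or.inr hm).mul
          ((hψ.continuous.comp continuous_fst).mul (hlc.comp continuous_snd)).continuousOn)
    · rw [mem_union, not_or] at hx
      rw [hfe, hη0 x hx.1, hl0 x hx.2]
      ring
    · rw [hfe, hψ0 t ht, hψ'0 t ht]
      ring
  have hgc : Continuous fun t => ∫ x, g t x := by
    refine continuous_integral_of_time_support hc.isCompact hψs ?_ (fun t x hx => ?_)
      fun t ht x => ?_
    · have h1 : Continuous fun x : EuclideanSpace ℝ (Fin N) => (1 + ‖x‖) ^ σ :=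
        (continuous_const.add continuous_norm).rpow_const fun x =>
          Or.inl (by positivity : 0 < 1 + ‖x‖).ne'
      exact ((h1.comp continuous_snd).continuousOn.mul
        (hus.rpow_const fun _ _ => Or.inr hp)).mul
        ((hψ.continuous.comp continuous_fst).mul (hη.continuous.comp continuous_snd)).continuousOn
    · rw [hg]
      simp [hη0 x hx]
    · rw [hg]
      simp [hψ0 t ht]
  have hweak : ∀ t ∈ Icc t₁ t₂, (∫ x, u x t * η x) + ∫ τ in (0 : ℝ)..t, ∫ x, f τ x =
      ∫ τ in (0 : ℝ)..t, ∫ x, g τ x := by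
    intro t ht
    have ht0 : 0 < t := h0.trans_le ht.1
    have := hu.weakForm _ htest t ⟨ht0, ht.2.trans_lt h2⟩
    simp only [(hψ1 t ht).1, one_mul] at this
    rw [intervalIntegral.integral_of_le ht0.le, intervalIntegral.integral_of_le ht0.le,
      integral_Ioc_eq_integral_Ioo, integral_Ioc_eq_integral_Ioo]
    exact this
  have e1 := hweak t₁ ⟨le_rfl, h12⟩
  have e2 := hweak t₂ ⟨h12, le_rfl⟩
  have d1 := intervalIntegral.integral_interval_sub_left (μ := volume) (hfc.intervalIntegrable 0 t₂)
    (hfc.intervalIntegrable 0 t₁)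
  have d2 := intervalIntegral.integral_interval_sub_left (μ := volume) (hgc.intervalIntegrable 0 t₂)
    (hgc.intervalIntegrable 0 t₁)
  have c1 : ∫ t in t₁..t₂, ∫ x, f t x = -∫ t in t₁..t₂, ∫ x, u x t ^ m * lapl η x := by
    rw [← intervalIntegral.integral_neg]
    refine intervalIntegral.integral_congr fun t ht => ?_
    rw [uIcc_of_le h12] at ht
    beta_reduce
    rw [← integral_neg]
    refine integral_congr_ae (Eventually.of_forall fun x => ?_)
    beta_reduce
    rw [hfe, (hψ1 t ht).1, (hψ1 t ht).2]
    ring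
  have c2 : ∫ t in t₁..t₂, ∫ x, g t x =
      ∫ t in t₁..t₂, ∫ x, (1 + ‖x‖) ^ σ * u x t ^ p * η x := by
    refine intervalIntegral.integral_congr fun t ht => ?_
    rw [uIcc_of_le h12] at ht
    simp only [hg, (hψ1 t ht).1, one_mul]
  rw [c1] at d1
  rw [c2] at d2
  linarith

end IsWeakSolution
end WeakForm

section Positivity

lemma mul_le_rpow_of_le {K p δ a : ℝ} (hp0 : 0 < p) (hp1 : p < 1) (hK : K ≤ δ ^ (p - 1))
    (ha : 0 ≤ a) (haδ : a ≤ δ) : K * a ≤ a ^ p := by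
  rcases ha.eq_or_lt with rfl | ha
  · rw [mul_zero, Real.zero_rpow hp0.ne']
  · calc K * a ≤ δ ^ (p - 1) * a := mul_le_mul_of_nonneg_right hK ha.le
      _ ≤ a ^ (p - 1) * a := mul_le_mul_of_nonneg_right
          (Real.rpow_le_rpow_of_nonpos ha haδ (by linarith)) ha.le
      _ = a ^ p := by rw [← Real.rpow_add_one ha.ne', sub_add_cancel]

lemma mul_le_reaction_add {K p δ r a b : ℝ} (hp0 : 0 < p) (hp1 : p < 1)
    (hK : K ≤ δ ^ (p - 1)) (hr : 1 ≤ r) (ha : 0 ≤ a) (haδ : a ≤ δ) (hb : 0 ≤ b) :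
    K * a ≤ r * b ^ p + K * max (a - b) 0 := by
  have h1 : b ^ p ≤ r * b ^ p := le_mul_of_one_le_left (Real.rpow_nonneg hb p) hr
  rcases le_total a b with hab | hab
  · rw [max_eq_right (by linarith), mul_zero, add_zero]
    exact (mul_le_rpow_of_le hp0 hp1 hK ha haδ).trans
      ((Real.rpow_le_rpow ha hab hp0.le).trans h1)
  · rw [max_eq_left (by linarith)]
    have := mul_le_rpow_of_le hp0 hp1 hK hb (hab.trans haδ)
    linarith

lemma rpow_sub_div_sub_nonneg {m a b : ℝ} (hm : 0 ≤ m) (ha : 0 ≤ a) (hb : 0 ≤ b) :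
    0 ≤ (a ^ m - b ^ m) / (a - b) := by
  rcases le_total a b with hab | hab
  · exact div_nonneg_of_nonpos (by linarith [Real.rpow_le_rpow ha hab hm]) (by linarith)
  · exact div_nonneg (by linarith [Real.rpow_le_rpow hb hab hm]) (by linarith)

lemma rpow_sub_div_sub_le {m M a b : ℝ} (hm : 1 ≤ m) (ha : a ∈ Icc 0 M) (hb : b ∈ Icc 0 M) :
    (a ^ m - b ^ m) / (a - b) ≤ m * M ^ (m - 1) := by
  have hM : 0 ≤ M := ha.1.trans ha.2
  have h := (convex_Icc (0 : ℝ) M).norm_image_sub_le_of_norm_hasDerivWithin_le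
    (f := fun x => x ^ m) (f' := fun x => m * x ^ (m - 1)) (C := m * M ^ (m - 1))
    (fun x _ => (Real.hasDerivAt_rpow_const (Or.inr hm)).hasDerivWithinAt) (fun x hx => ?_) hb ha
  · refine (le_abs_self _).trans ?_
    rw [abs_div]
    refine div_le_of_le_mul₀ (abs_nonneg _) (by positivity) h
  · rw [Real.norm_eq_abs, abs_of_nonneg (mul_nonneg (by linarith) (Real.rpow_nonneg hx.1 _))]
    exact mul_le_mul_of_nonneg_left (Real.rpow_le_rpow hx.1 hx.2 (by linarith)) (by linarith)

variable {N : ℕ}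

/-- The weak inequality for a function that agrees on a time interval with a travelling
paraboloid. -/
lemma integral_sub_mul_le_of_eq_travelling [Nonempty (Fin N)] {m α δ ℓ t₁ t₂ : ℝ} (hm : 1 < m)
    (hm2 : m < 2) (hα : α * (m - 1) = 1) (hδ : 0 < δ) (hℓ : 0 < ℓ)
    {c v : EuclideanSpace ℝ (Fin N)} (hv : ‖v‖ * ℓ ≤ (α + 1) * δ ^ (m - 1))
    {w : EuclideanSpace ℝ (Fin N) → ℝ → ℝ} (h12 : t₁ ≤ t₂)
    (hw : ∀ x, ∀ t ∈ Icc t₁ t₂, w x t = δ * travelling α ℓ c v x t)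
    {η : EuclideanSpace ℝ (Fin N) → ℝ} (hη : ContDiff ℝ (⊤ : ℕ∞) η) (hc : HasCompactSupport η)
    (hη0 : ∀ x, 0 ≤ η x) :
    ∫ x, (w x t₂ - w x t₁) * η x ≤
      (∫ x, (∫ t in t₁..t₂, w x t ^ m) * lapl η x) +
        ∫ x, ((α + 1) * (2 * N + 2 * α) * δ ^ (m - 1) / ℓ ^ 2 * ∫ t in t₁..t₂, w x t) * η x := by
  have hα1 : 1 < α := by nlinarith
  have h := integral_sub_mul_le_of_le_lapl (η := η)
    (w := fun x t => δ * travelling α ℓ c v x t)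
    (W := fun x t => δ ^ m * travelling (α + 1) ℓ c v x t)
    (K := (α + 1) * (2 * N + 2 * α) * δ ^ (m - 1) / ℓ ^ 2)
    (w' := fun x t => δ * (α * travelling (α - 1) ℓ c v x t *
      (2 * ⟪x - (c + t • v), v⟫ / ℓ ^ 2)))
    (continuous_const.mul (continuous_travelling (by linarith) ℓ c v))
    (by
      have := continuous_travelling (β := α - 1) (by linarith) ℓ c v
      refine continuous_const.mul ((continuous_const.mul this).mul ?_)
      fun_prop)
    (fun x t => (hasDerivAt_travelling hα1 ℓ c v x t).const_mul δ)
    (continuous_const.mul (continuous_travelling (by linarith) ℓ c v))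
    (fun t => contDiff_const.mul (contDiff_travelling (by linarith) ℓ c v t))
    (continuous_lapl_travelling (by linarith) _ ℓ c v)
    (fun x t => deriv_travelling_le_lapl hα1 hδ hℓ hv x t) h12 hη hc hη0
  have e1 : ∀ x, ∫ t in t₁..t₂, w x t ^ m =
      ∫ t in t₁..t₂, δ ^ m * travelling (α + 1) ℓ c v x t := fun x => by
    refine intervalIntegral.integral_congr fun t ht => ?_
    rw [uIcc_of_le h12] at ht
    rw [hw x t ht, Real.mul_rpow hδ.le (travelling_nonneg _ _ _ _ _ _), travelling, travelling,
      ← Real.rpow_mul (le_max_right _ _), show α * m = α + 1 by linarith]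
  have e2 : ∀ x, ∫ t in t₁..t₂, w x t = ∫ t in t₁..t₂, δ * travelling α ℓ c v x t := fun x => by
    refine intervalIntegral.integral_congr fun t ht => ?_
    rw [uIcc_of_le h12] at ht
    exact hw x t ht
  simp only [e1, e2, hw _ t₁ ⟨le_rfl, h12⟩, hw _ t₂ ⟨h12, le_rfl⟩]
  exact h

/-- Subtracting a weak solution from a weak subsolution of the equation with linear reaction. -/
lemma integral_sub_sub_mul_le {m p σ δ K t₁ t₂ : ℝ} (hm : 0 ≤ m) (hp0 : 0 < p) (hp1 : p < 1)
    (hσ : 0 ≤ σ) (hK : K ≤ δ ^ (p - 1)) (h12 : t₁ ≤ t₂)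
    {w U : EuclideanSpace ℝ (Fin N) → ℝ → ℝ} (hwc : Continuous (Function.uncurry w))
    (hUc : Continuous (Function.uncurry U)) (hw0 : ∀ x t, 0 ≤ w x t) (hwδ : ∀ x t, w x t ≤ δ)
    (hU0 : ∀ x t, 0 ≤ U x t)
    {η : EuclideanSpace ℝ (Fin N) → ℝ} (hη : ContDiff ℝ (⊤ : ℕ∞) η) (hc : HasCompactSupport η)
    (hη0 : ∀ x, 0 ≤ η x)
    (hw : ∫ x, (w x t₂ - w x t₁) * η x ≤
      (∫ x, (∫ t in t₁..t₂, w x t ^ m) * lapl η x) +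
        ∫ x, (K * ∫ t in t₁..t₂, w x t) * η x)
    (hU : ∫ x, (U x t₂ - U x t₁) * η x =
      (∫ x, (∫ t in t₁..t₂, U x t ^ m) * lapl η x) +
        ∫ x, (∫ t in t₁..t₂, (1 + ‖x‖) ^ σ * U x t ^ p) * η x) :
    ∫ x, (w x t₂ - U x t₂ - (w x t₁ - U x t₁)) * η x ≤
      (∫ x, (∫ t in t₁..t₂, (w x t ^ m - U x t ^ m)) * lapl η x) +
        ∫ x, (K * ∫ t in t₁..t₂, max (w x t - U x t) 0) * η x := by
  have hη2 : ContDiff ℝ 2 η := hη.of_le (WithTop.coe_le_coe.2 (le_top (a := (2 : ℕ∞))))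
  have hUm : Continuous (Function.uncurry fun x t => U x t ^ m) :=
    hUc.rpow_const fun _ => Or.inr hm
  have hwm : Continuous (Function.uncurry fun x t => w x t ^ m) :=
    hwc.rpow_const fun _ => Or.inr hm
  have hwt : Continuous fun x : EuclideanSpace ℝ (Fin N) => (1 + ‖x‖) ^ σ :=
    (continuous_const.add continuous_norm).rpow_const fun x =>
      Or.inl (by positivity : 0 < 1 + ‖x‖).ne'
  have hUp : Continuous (Function.uncurry fun x t => (1 + ‖x‖) ^ σ * U x t ^ p) :=
    (hwt.comp continuous_fst).mul (hUc.rpow_const fun _ => Or.inr hp0.le)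
  have hmax : Continuous (Function.uncurry fun x t => max (w x t - U x t) 0) :=
    (hwc.sub hUc).max continuous_const
  have hi : ∀ {f : EuclideanSpace ℝ (Fin N) → ℝ}, Continuous f →
      Integrable fun x => f x * η x := fun hf =>
    (hf.mul hη.continuous).integrable_of_hasCompactSupport hc.mul_left
  have hil : ∀ {f : EuclideanSpace ℝ (Fin N) → ℝ}, Continuous f →
      Integrable fun x => f x * lapl η x := fun hf =>
    (hf.mul (continuous_lapl hη2)).integrable_of_hasCompactSupport
      (hasCompactSupport_lapl hc).mul_left
  have e0 : ∫ x, (w x t₂ - U x t₂ - (w x t₁ - U x t₁)) * η x =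
      (∫ x, (w x t₂ - w x t₁) * η x) - ∫ x, (U x t₂ - U x t₁) * η x := by
    have k1 : Continuous fun x => w x t₂ - w x t₁ :=
      (continuous_slice hwc _).sub (continuous_slice hwc _)
    have k2 : Continuous fun x => U x t₂ - U x t₁ :=
      (continuous_slice hUc _).sub (continuous_slice hUc _)
    rw [← integral_sub (hi k1) (hi k2)]
    exact integral_congr_ae (Eventually.of_forall fun x => by ring)
  have e1 : ∫ x, (∫ t in t₁..t₂, (w x t ^ m - U x t ^ m)) * lapl η x =
      (∫ x, (∫ t in t₁..t₂, w x t ^ m) * lapl η x) -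
        ∫ x, (∫ t in t₁..t₂, U x t ^ m) * lapl η x := by
    rw [← integral_sub (hil (continuous_integral_time hwm _ _))
      (hil (continuous_integral_time hUm _ _))]
    refine integral_congr_ae (Eventually.of_forall fun x => ?_)
    beta_reduce
    rw [← sub_mul, ← intervalIntegral.integral_sub
      ((continuous_path hwm x).intervalIntegrable _ _)
      ((continuous_path hUm x).intervalIntegrable _ _)]
  have e2 : (∫ x, (K * ∫ t in t₁..t₂, w x t) * η x) -
      ∫ x, (∫ t in t₁..t₂, (1 + ‖x‖) ^ σ * U x t ^ p) * η x ≤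
      ∫ x, (K * ∫ t in t₁..t₂, max (w x t - U x t) 0) * η x := by
    have k1 : Continuous fun x => K * ∫ t in t₁..t₂, w x t :=
      (continuous_integral_time hwc t₁ t₂).const_mul K
    have k2 := continuous_integral_time hUp t₁ t₂
    have k3 : Continuous fun x => K * ∫ t in t₁..t₂, max (w x t - U x t) 0 :=
      (continuous_integral_time hmax t₁ t₂).const_mul K
    rw [← integral_sub (hi k1) (hi k2)]
    refine integral_mono ((hi k1).sub (hi k2)) (hi k3) fun x => ?_
    beta_reduce
    rw [← sub_mul]
    refine mul_le_mul_of_nonneg_right ?_ (hη0 x)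
    have j1 : Continuous fun t => K * w x t := (continuous_path hwc x).const_mul K
    have j2 := continuous_path hUp x
    have j3 : Continuous fun t => K * max (w x t - U x t) 0 :=
      (continuous_path hmax x).const_mul K
    rw [← intervalIntegral.integral_const_mul, ← intervalIntegral.integral_const_mul,
      ← intervalIntegral.integral_sub (j1.intervalIntegrable _ _)
        (j2.intervalIntegrable _ _)]
    refine intervalIntegral.integral_mono_on h12 ((j1.sub j2).intervalIntegrable _ _)
      (j3.intervalIntegrable _ _) fun t _ => ?_
    have := mul_le_reaction_add hp0 hp1 hK
      (Real.one_le_rpow (by linarith [norm_nonneg x] : (1 : ℝ) ≤ 1 + ‖x‖) hσ)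
      (hw0 x t) (hwδ x t) (hU0 x t)
    linarith
  rw [e0, e1]
  linarith

namespace IsWeakSolution
variable {m p σ T : ℝ} {u : EuclideanSpace ℝ (Fin N) → ℝ → ℝ}
  {u₀ : EuclideanSpace ℝ (Fin N) → ℝ}

lemma integral_clamp_sub_mul_eq (hu : IsWeakSolution m p σ T u u₀) (hm : 0 ≤ m) (hp : 0 ≤ p)
    (huc : ContinuousOn (Function.uncurry u) (univ ×ˢ Ioo (0 : ℝ) T))
    {U : EuclideanSpace ℝ (Fin N) → ℝ → ℝ} (hU : Continuous (Function.uncurry U))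
    {η : EuclideanSpace ℝ (Fin N) → ℝ} (hη : ContDiff ℝ (⊤ : ℕ∞) η) (hc : HasCompactSupport η)
    {t₁ t₂ : ℝ} (h0 : 0 < t₁) (h12 : t₁ ≤ t₂) (h2 : t₂ < T)
    (hUu : ∀ x, ∀ t ∈ Icc t₁ t₂, U x t = u x t) :
    ∫ x, (U x t₂ - U x t₁) * η x =
      (∫ x, (∫ t in t₁..t₂, U x t ^ m) * lapl η x) +
        ∫ x, (∫ t in t₁..t₂, (1 + ‖x‖) ^ σ * U x t ^ p) * η x := by
  have hη2 : ContDiff ℝ 2 η := hη.of_le (WithTop.coe_le_coe.2 (le_top (a := (2 : ℕ∞))))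
  have h1 : Continuous fun x : EuclideanSpace ℝ (Fin N) => (1 + ‖x‖) ^ σ :=
    (continuous_const.add continuous_norm).rpow_const fun x =>
      Or.inl (by positivity : 0 < 1 + ‖x‖).ne'
  have hUm : Continuous (Function.uncurry fun x t => U x t ^ m) :=
    hU.rpow_const fun _ => Or.inr hm
  have hUp : Continuous (Function.uncurry fun x t => (1 + ‖x‖) ^ σ * U x t ^ p) :=
    (h1.comp continuous_fst).mul (hU.rpow_const fun _ => Or.inr hp)
  have hi : ∀ t, Integrable fun x => U x t * η x := fun t =>
    ((continuous_slice hU t).mul hη.continuous).integrable_of_hasCompactSupport hc.mul_left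
  have key := hu.integral_mul_sub_eq hm hp huc hη hc h0 h12 h2
  have e : ∀ x, U x t₂ = u x t₂ ∧ U x t₁ = u x t₁ := fun x =>
    ⟨hUu x t₂ ⟨h12, le_rfl⟩, hUu x t₁ ⟨le_rfl, h12⟩⟩
  have c1 : ∫ t in t₁..t₂, ∫ x, u x t ^ m * lapl η x =
      ∫ t in t₁..t₂, ∫ x, U x t ^ m * lapl η x := by
    refine intervalIntegral.integral_congr fun t ht => ?_
    rw [uIcc_of_le h12] at ht
    simp only [hUu _ t ht]
  have c2 : ∫ t in t₁..t₂, ∫ x, (1 + ‖x‖) ^ σ * u x t ^ p * η x =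
      ∫ t in t₁..t₂, ∫ x, (1 + ‖x‖) ^ σ * U x t ^ p * η x := by
    refine intervalIntegral.integral_congr fun t ht => ?_
    rw [uIcc_of_le h12] at ht
    simp only [hUu _ t ht]
  rw [c1, c2, integral_time_mul hUm (continuous_lapl hη2) (hasCompactSupport_lapl hc),
    integral_time_mul hUp hη.continuous hc] at key
  rw [← key]
  simp only [sub_mul]
  rw [integral_sub (hi _) (hi _)]
  simp only [fun x => (e x).1, fun x => (e x).2]

/-- Comparison from below with a travelling paraboloid. -/
lemma travelling_le [Nonempty (Fin N)] (hu : IsWeakSolution m p σ T u u₀) (hm : 1 < m)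
    (hm2 : m < 2) (hp0 : 0 < p) (hp1 : p < 1) (hσ : 0 ≤ σ)
    (huc : ContinuousOn (Function.uncurry u) (univ ×ˢ Ioo (0 : ℝ) T))
    {α δ ℓ s e : ℝ} (hα : α * (m - 1) = 1) (hδ : 0 < δ) (hℓ : 0 < ℓ)
    {c v : EuclideanSpace ℝ (Fin N)} (hv : ‖v‖ * ℓ ≤ (α + 1) * δ ^ (m - 1))
    (hK : (α + 1) * (2 * N + 2 * α) * δ ^ (m - 1) / ℓ ^ 2 ≤ δ ^ (p - 1))
    (hs : 0 < s) (hse : s ≤ e) (heT : e < T)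
    (hinit : ∀ x, δ * travelling α ℓ c v x s ≤ u x s) (x : EuclideanSpace ℝ (Fin N)) :
    δ * travelling α ℓ c v x e ≤ u x e := by
  have hα1 : 1 < α := by nlinarith
  have hK0 : 0 ≤ (α + 1) * (2 * N + 2 * α) * δ ^ (m - 1) / ℓ ^ 2 := by positivity
  obtain ⟨cl, hclc, hclm, hcle⟩ : ∃ cl : ℝ → ℝ, Continuous cl ∧ (∀ t, cl t ∈ Icc s e) ∧
      ∀ t ∈ Icc s e, cl t = t :=
    ⟨fun t => max s (min t e), continuous_const.max (continuous_id.min continuous_const),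
      fun t => ⟨le_max_left _ _, max_le hse (min_le_right _ _)⟩,
      fun t ht => by simp only [min_eq_left ht.2, max_eq_right ht.1]⟩
  have hclT : ∀ t, cl t ∈ Ioo 0 T := fun t => ⟨hs.trans_le (hclm t).1, (hclm t).2.trans_lt heT⟩
  obtain ⟨U, hU⟩ : ∃ U : EuclideanSpace ℝ (Fin N) → ℝ → ℝ, ∀ x t, U x t = u x (cl t) :=
    ⟨fun x t => u x (cl t), fun _ _ => rfl⟩
  obtain ⟨w, hw⟩ : ∃ w : EuclideanSpace ℝ (Fin N) → ℝ → ℝ,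
      ∀ x t, w x t = δ * travelling α ℓ c v x (cl t) :=
    ⟨fun x t => δ * travelling α ℓ c v x (cl t), fun _ _ => rfl⟩
  have hw0 : ∀ x t, 0 ≤ w x t := fun x t => by
    rw [hw]
    exact mul_nonneg hδ.le (travelling_nonneg _ _ _ _ _ _)
  have hwδ : ∀ x t, w x t ≤ δ := fun x t => by
    rw [hw]
    exact mul_le_of_le_one_right hδ.le (travelling_le_one (by linarith) _ _ _ _ _)
  have hU0 : ∀ x t, 0 ≤ U x t := fun x t => by
    rw [hU]
    exact hu.nonneg x _ (hclT t)
  have hUc : Continuous (Function.uncurry U) := by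
    have : Continuous fun q : EuclideanSpace ℝ (Fin N) × ℝ => Function.uncurry u (q.1, cl q.2) :=
      huc.comp_continuous (continuous_fst.prodMk (hclc.comp continuous_snd))
        fun q => ⟨mem_univ _, hclT q.2⟩
    exact this.congr fun q => (hU q.1 q.2).symm
  have hwc : Continuous (Function.uncurry w) := by
    have : Continuous fun q : EuclideanSpace ℝ (Fin N) × ℝ =>
        δ * Function.uncurry (travelling α ℓ c v) (q.1, cl q.2) :=
      continuous_const.mul ((continuous_travelling (by linarith) ℓ c v).comp
        (continuous_fst.prodMk (hclc.comp continuous_snd)))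
    exact this.congr fun q => (hw q.1 q.2).symm
  obtain ⟨R, hR⟩ : ∃ R, R = ‖c‖ + e * ‖v‖ + ℓ := ⟨_, rfl⟩
  have hR0 : 0 ≤ R := hR ▸ add_nonneg (add_nonneg (norm_nonneg _)
    (mul_nonneg (hs.le.trans hse) (norm_nonneg _))) hℓ.le
  have hfar : ∀ x ∉ Metric.closedBall (0 : EuclideanSpace ℝ (Fin N)) R, ∀ t, w x t = 0 := by
    intro x hx t
    rw [mem_closedBall_zero_iff, not_le] at hx
    have h1 : ‖cl t • v‖ ≤ e * ‖v‖ := by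
      rw [norm_smul, Real.norm_eq_abs, abs_of_pos (hclT t).1]
      exact mul_le_mul_of_nonneg_right (hclm t).2 (norm_nonneg _)
    have h2 := norm_sub_norm_le x (c + cl t • v)
    have h3 := norm_add_le c (cl t • v)
    rw [hw, travelling_eq_zero (by linarith) hℓ (by linarith), mul_zero]
  obtain ⟨M, hM⟩ := ((isCompact_closedBall (0 : EuclideanSpace ℝ (Fin N)) (R + 1)).prod
    (isCompact_Icc (a := s) (b := e))).exists_bound_of_continuousOn hUc.continuousOn
  have hsub : IsSubsolution ((α + 1) * (2 * N + 2 * α) * δ ^ (m - 1) / ℓ ^ 2)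
      (m * max δ M ^ (m - 1)) R s e (fun x t => w x t - U x t)
      (fun x t => w x t ^ m - U x t ^ m) :=
    { continuous := hwc.sub hUc
      continuous_flux := (hwc.rpow_const fun _ => Or.inr (by linarith)).sub
        (hUc.rpow_const fun _ => Or.inr (by linarith))
      nonpos_of_far := fun x hx t => by
        rw [hfar x hx t]
        linarith [hU0 x t]
      flux_nonpos_of_far := fun x hx t => by
        rw [hfar x hx t, Real.zero_rpow (by linarith)]
        linarith [Real.rpow_nonneg (hU0 x t) m]
      flux_eq_zero := fun x t h => by rw [sub_eq_zero.1 h, sub_self]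
      div_nonneg := fun x t => rpow_sub_div_sub_nonneg (by linarith) (hw0 _ _) (hU0 _ _)
      div_le := fun x hx t => by
        refine rpow_sub_div_sub_le hm.le ⟨hw0 _ _, (hwδ _ _).trans (le_max_left _ _)⟩
          ⟨hU0 _ _, le_trans ?_ (le_max_right _ _)⟩
        have h1 : U x (cl t) ≤ M := (le_abs_self _).trans (hM (x, cl t) ⟨hx, hclm t⟩)
        rwa [hU, hcle _ (hclm t), ← hU] at h1
      sub := fun t₁ t₂ h1 h12 h2 η hη hc hη0 => by
        have hcl : ∀ t ∈ Icc t₁ t₂, cl t = t := fun t ht =>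
          hcle t ⟨h1.trans ht.1, ht.2.trans h2⟩
        exact integral_sub_sub_mul_le (by linarith) hp0 hp1 hσ hK h12 hwc hUc hw0 hwδ hU0 hη hc hη0
          (integral_sub_mul_le_of_eq_travelling hm hm2 hα hδ hℓ hv h12
            (fun x t ht => by rw [hw, hcl t ht]) hη hc hη0)
          (hu.integral_clamp_sub_mul_eq (by linarith) hp0.le huc hUc hη hc
            (hs.trans_le h1) h12 (h2.trans_lt heT) fun x t ht => by rw [hU, hcl t ht])
      init := fun x => by
        rw [hw, hU, hcle s ⟨le_rfl, hse⟩]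
        exact sub_nonpos.2 (hinit x) }
  have := hsub.nonpos hK0 hR0 (t := e) ⟨hse, le_rfl⟩ x
  rw [hw, hU, hcle e ⟨hse, le_rfl⟩] at this
  exact sub_nonpos.1 this

lemma exists_pos (hu : IsWeakSolution m p σ T u u₀) (hu₀ : Continuous u₀)
    (hu₀c : HasCompactSupport u₀) (hu₀nonneg : ∀ x, 0 ≤ u₀ x) (hu₀ne : u₀ ≠ 0) {t : ℝ}
    (ht : t ∈ Ioo 0 T) : ∃ s ∈ Ioo 0 t, ∃ x, 0 < u x s := by
  by_contra! h
  obtain ⟨a, ha⟩ := Function.ne_iff.1 hu₀ne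
  have hpos : 0 < ∫ x, u₀ x :=
    hu₀.integral_pos_of_hasCompactSupport_nonneg_nonzero hu₀c hu₀nonneg ha
  have hlim := hu.initL1 (tsupport u₀) hu₀c.isCompact
  refine hpos.ne' (tendsto_nhds_unique (tendsto_const_nhds.congr' ?_) hlim)
  filter_upwards [Ioo_mem_nhdsGT ht.1] with s hs
  have h0 : ∀ x, u x s = 0 := fun x =>
    le_antisymm (h s hs x) (hu.nonneg x s ⟨hs.1, hs.2.trans ht.2⟩)
  simp only [h0, zero_sub, abs_neg, abs_of_nonneg (hu₀nonneg _)]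
  exact (setIntegral_eq_integral_of_forall_compl_eq_zero fun x hx =>
    image_eq_zero_of_notMem_tsupport hx).symm

lemma exists_barrier_parameters (hmp : m + p < 2) (hmp' : p < m) {b c₁ V ε r : ℝ}
    (hb : 0 < b) (hc₁ : 0 < c₁) (hε : 0 < ε) (hr : 0 < r) :
    ∃ δ ℓ : ℝ, 0 < δ ∧ 0 < ℓ ∧ δ ≤ ε ∧ ℓ ≤ r ∧ V * ℓ ≤ b * δ ^ (m - 1) ∧
      c₁ * δ ^ (m - 1) / ℓ ^ 2 ≤ δ ^ (p - 1) := by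
  have hlim : ∀ (a C : ℝ), 0 < a →
      Tendsto (fun δ : ℝ => C * δ ^ a) (nhdsWithin 0 (Ioi 0)) (nhds 0) := fun a C ha => by
    have h := ((Real.continuous_rpow_const ha.le).const_mul C).tendsto (0 : ℝ)
    rw [Real.zero_rpow ha.ne', mul_zero] at h
    exact h.mono_left nhdsWithin_le_nhds
  have e1 := (hlim ((m - p) / 2) (√c₁) (by linarith)).eventually_le_const hr
  have e2 := (hlim ((2 - m - p) / 2) (V * √c₁) (by linarith)).eventually_le_const hb
  obtain ⟨δ, h1, h2, hδ⟩ := (e1.and (e2.and (Ioc_mem_nhdsGT hε))).exists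
  have hδ0 : 0 < δ := hδ.1
  refine ⟨δ, √c₁ * δ ^ ((m - p) / 2), hδ0, by positivity, hδ.2, h1, ?_, le_of_eq ?_⟩
  · calc V * (√c₁ * δ ^ ((m - p) / 2)) = V * √c₁ * δ ^ ((2 - m - p) / 2) * δ ^ (m - 1) := by
          rw [mul_assoc (V * √c₁), ← Real.rpow_add hδ0]
          ring_nf
      _ ≤ b * δ ^ (m - 1) := mul_le_mul_of_nonneg_right h2 (by positivity)
  · rw [mul_pow, Real.sq_sqrt hc₁.le, ← Real.rpow_natCast (δ ^ ((m - p) / 2)),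
      ← Real.rpow_mul hδ0.le, mul_div_mul_left _ _ hc₁.ne', ← Real.rpow_sub hδ0]
    congr 1
    push_cast
    ring

end IsWeakSolution
end Positivity

/-- Infinite speed of propagation when m + p < 2, for any σ ≥ 0. -/
theorem infinite_speed_of_propagation
    {N : ℕ} (hN : 1 ≤ N) {m p σ T : ℝ} (hm : 1 < m) (hp0 : 0 < p) (hp1 : p < 1)
    (hmp : m + p < 2) (hσ : 0 ≤ σ) (hT : 0 < T)
    (u₀ : EuclideanSpace ℝ (Fin N) → ℝ)
    (hu₀cont : Continuous u₀) (hu₀bdd : ∃ C : ℝ, ∀ x, u₀ x ≤ C)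
    (hu₀supp : HasCompactSupport u₀)
    (hu₀nonneg : ∀ x, 0 ≤ u₀ x) (hu₀ne : u₀ ≠ 0)
    (u : EuclideanSpace ℝ (Fin N) → ℝ → ℝ)
    (hu : IsWeakSolution m p σ T u u₀)
    (hucont : ContinuousOn (Function.uncurry u) (univ ×ˢ Ioo (0:ℝ) T)) :
    ∀ x : EuclideanSpace ℝ (Fin N), ∀ t ∈ Ioo (0:ℝ) T, 0 < u x t := by
  intro x t ht
  have : Nonempty (Fin N) := ⟨⟨0, hN⟩⟩
  obtain ⟨s, hs, x₀, hx₀⟩ := hu.exists_pos hu₀cont hu₀supp hu₀nonneg hu₀ne ht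
  have hsT : s ∈ Ioo 0 T := ⟨hs.1, hs.2.trans ht.2⟩
  have hus : Continuous fun y => u y s :=
    hucont.comp_continuous (continuous_id.prodMk continuous_const) fun y => ⟨mem_univ _, hsT⟩
  obtain ⟨r, hr, hball⟩ := Metric.nhds_basis_closedBall.mem_iff.1
    (hus.continuousAt.eventually_const_lt (half_lt_self hx₀))
  set α := 1 / (m - 1) with hα
  have hα0 : 0 < α := one_div_pos.2 (by linarith)
  set v := (t - s)⁻¹ • (x - x₀) with hv
  have hts : t - s ≠ 0 := (sub_pos.2 hs.2).ne'
  obtain ⟨δ, ℓ, hδ, hℓ, hδε, hℓr, hvℓ, hK⟩ := IsWeakSolution.exists_barrier_parameters hmp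
    (by linarith) (b := α + 1) (c₁ := (α + 1) * (2 * N + 2 * α)) (V := ‖v‖) (by linarith)
    (by positivity) (half_pos hx₀) hr
  have h0 : x₀ - s • v + s • v = x₀ := sub_add_cancel _ _
  have h1 : x₀ - s • v + t • v = x := by
    rw [sub_add_eq_add_sub, add_sub_assoc, ← sub_smul, hv, smul_inv_smul₀ hts, add_sub_cancel]
  have hle := hu.travelling_le (x := x) (c := x₀ - s • v) hm (by linarith) hp0 hp1 hσ hucont
    (one_div_mul_cancel (by linarith : m - 1 ≠ 0)) hδ hℓ hvℓ hK hs.1 hs.2.le ht.2 fun y => ?_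
  · have hself := travelling_self α ℓ (x₀ - s • v) v t
    rw [h1] at hself
    rw [hself, mul_one] at hle
    exact hδ.trans_le hle
  · rcases lt_or_ge ‖y - x₀‖ ℓ with hy | hy
    · have hy' : y ∈ Metric.closedBall x₀ r := by
        rw [mem_closedBall_iff_norm]
        exact hy.le.trans hℓr
      exact (mul_le_of_le_one_right hδ.le (travelling_le_one hα0.le _ _ _ _ _)).trans
        (hδε.trans (le_of_lt (hball hy')))
    · rw [travelling_eq_zero hα0 hℓ (by rwa [h0]), mul_zero]
      exact hu.nonneg y s hsT
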